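/- arXiv:2210.12290 — 8 statements merged into one kernel-verified Lean document; each statement's English description precedes it below -/
import Mathlib

section
/- For any coloring of the rational numbers into finitely many colors, there exist nonzero rationals x and y such that the set {x, y, x*y, x + y} is monochromatic. -/
open Finset

/-- The set of sums of `y` over nonempty subsets of the first `R` indices. -/
def finiteSums (R : ℕ) (y : ℕ → ℚ) : Set ℚ :=
  {x | ∃ H : Finset ℕ, H.Nonempty ∧ H ⊆ range R ∧ x = ∑ i ∈ H, y i}

lemma finiteSums_mono {R R' : ℕ} (h : R ≤ R') (y : ℕ → ℚ) :
    finiteSums R y ⊆ finiteSums R' y := by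
  rintro x ⟨H, hne, hH, rfl⟩
  exact ⟨H, hne, hH.trans (range_subset_range.2 h), rfl⟩

open Classical in
/-- The block sums of `y` along the active coordinates of the template `f`. -/
noncomputable def blockSum {R r : ℕ} {α : Type} (f : Fin R → α ⊕ Fin r) (y : ℕ → ℚ) (e : ℕ) : ℚ :=
  ∑ i : Fin R, if ∃ e' : Fin r, f i = Sum.inr e' ∧ e'.val = e then y i else 0

open Classical in
lemma sum_blockSum {R r : ℕ} {α : Type} (f : Fin R → α ⊕ Fin r) (y : ℕ → ℚ) (H : Finset ℕ) :
    ∑ e ∈ H, blockSum f y e =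
      ∑ i : Fin R, if ∃ e' : Fin r, f i = Sum.inr e' ∧ e'.val ∈ H then y i else 0 := by
  unfold blockSum
  rw [sum_comm]
  refine sum_congr rfl fun i _ => ?_
  rcases hf : f i with v | e'
  · simp
  · simp

open Classical in
lemma finiteSums_blockSum_subset {R r : ℕ} {α : Type} (f : Fin R → α ⊕ Fin r)
    (hf : ∀ e, ∃ i, f i = Sum.inr e) (y : ℕ → ℚ) :
    finiteSums r (blockSum f y) ⊆ finiteSums R y := by
  rintro x ⟨H, ⟨e, he⟩, hH, rfl⟩
  rw [sum_blockSum, ← sum_filter]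
  refine ⟨(univ.filter fun i : Fin R =>
    ∃ e' : Fin r, f i = Sum.inr e' ∧ e'.val ∈ H).map Fin.valEmbedding, ?_, ?_, ?_⟩
  · obtain ⟨i, hi⟩ := hf ⟨e, mem_range.1 (hH he)⟩
    exact ⟨i, by simpa using ⟨i, ⟨⟨e, _⟩, hi, he⟩, rfl⟩⟩
  · intro i hi
    simp only [mem_map, mem_filter] at hi
    obtain ⟨a, -, rfl⟩ := hi
    simp
  · simp [sum_map]

/-- Finitary IP van der Waerden theorem with a list of outcomes that does not depend on the
coloring. -/
lemma exists_finiteSums_shift_invariant (κ M : Type) [Finite κ] [Finite M] (r : ℕ) :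
    ∃ (R : ℕ) (O : Type) (_ : Finite O), ∀ (y : ℕ → ℚ) (F : M → ℕ → ℚ),
      ∃ (s : O → ℕ → ℚ) (z : O → ℕ → ℚ), (∀ o, finiteSums r (z o) ⊆ finiteSums R y) ∧
        ∀ (χ : (ℕ → ℚ) → κ) (w : ℕ → ℚ), ∃ o, ∀ x ∈ finiteSums r (z o), ∀ m,
          χ (w + s o + x • F m) = χ (w + s o) := by
  classical
  obtain ⟨R, hR⟩ :=
    Combinatorics.Subspace.exists_mono_in_high_dimension_fin (Option M) κ (Fin r)
  refine ⟨R, {f : Fin R → Option M ⊕ Fin r // ∀ e, ∃ i, f i = Sum.inr e}, inferInstance,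
    fun y F => ?_⟩
  let F' : Option M → ℕ → ℚ := fun v => v.elim 0 F
  refine ⟨fun f => ∑ i : Fin R, y i • Sum.elim F' 0 (f.1 i), fun f => blockSum f.1 y,
    fun f => finiteSums_blockSum_subset f.1 f.2 y, fun χ w => ?_⟩
  obtain ⟨l, c, hl⟩ := hR fun v => χ (w + ∑ i : Fin R, y i • F' (v i))
  refine ⟨⟨l.idxFun, l.proper⟩, ?_⟩
  have key : ∀ (H : Finset ℕ) (m : M),
      χ (w + ∑ i : Fin R, y i • Sum.elim F' 0 (l.idxFun i) + (∑ e ∈ H, blockSum l.idxFun y e) • F m)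
        = c := by
    intro H m
    rw [← hl fun e => if e.val ∈ H then some m else none, add_assoc]
    congr 2
    rw [sum_blockSum, sum_smul, ← sum_add_distrib]
    refine sum_congr rfl fun i _ => ?_
    rw [Combinatorics.Subspace.apply_def]
    rcases hf : l.idxFun i with v | e'
    · simp
    · by_cases h : e'.val ∈ H <;> simp [h, F']
  rintro x ⟨H, -, -, rfl⟩ m
  have h0 := key ∅ m
  rw [sum_empty, zero_smul, add_zero] at h0
  exact (key H m).trans h0.symm

/-- Compatibility of the levels `a, …, k - 1`, with a new top level `w`, for the coloring `c`. -/
def TopCompatible {κ : Type} (c : ℚ → κ) (k r a : ℕ) (w x : ℕ → ℚ) : Prop :=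
  ∀ i j, a ≤ i → i < j → j ≤ k → ∀ u ∈ finiteSums r w,
    c ((∏ t ∈ Ico j k, x t) * u) = c ((∏ t ∈ Ico j k, x t) * u + ∏ t ∈ Ico i j, x t)

lemma exists_topCompatible {κ : Type} [Finite κ] (c : ℚ → κ) (k r d : ℕ) (hd : d ≤ k) :
    ∃ (R : ℕ) (O : Type) (_ : Finite O), ∀ ys : ℕ → ℕ → ℚ,
      (∀ i, ∀ x ∈ finiteSums R (ys i), x ≠ 0) →
      ∃ (s : O → ℕ → ℚ) (zs : O → ℕ → ℕ → ℚ),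
        (∀ o i, finiteSums r (zs o i) ⊆ finiteSums R (ys i)) ∧
        ∀ w, ∃ o, ∀ x : ℕ → ℚ, (∀ i, k - d ≤ i → i < k → x i ∈ finiteSums r (zs o i)) →
          TopCompatible c k r (k - d) (w + s o) x := by
  classical
  induction d with
  | zero =>
    exact ⟨r, Unit, inferInstance, fun ys _ => ⟨0, fun _ => ys, fun _ _ => subset_rfl,
      fun _ => ⟨(), fun _ _ i j _ _ _ => by omega⟩⟩⟩
  | succ d ih =>
    obtain ⟨R₁, O₁, _, ih⟩ := ih (by omega)
    obtain ⟨b, hb⟩ : ∃ b, b + (d + 1) = k := ⟨k - (d + 1), by omega⟩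
    let I := Fin k → (range R₁).powerset
    let T := I × Fin (k + 1) × (range r).powerset
    let M := I × Fin (k + 1) × Fin r
    obtain ⟨R₀, O₀, _, h₀⟩ := exists_finiteSums_shift_invariant (O₁ × (T → κ)) M r
    refine ⟨max R₀ R₁, O₁ × O₀, inferInstance, fun ys hys => ?_⟩
    obtain ⟨s₁, zs₁, hz₁, h₁⟩ := ih ys fun i x hx =>
      hys i x (finiteSums_mono (le_max_right _ _) _ hx)
    choose o₁ ho₁ using h₁
    let X : I → ℕ → ℚ := fun idx i => if h : i < k then ∑ e ∈ (idx ⟨i, h⟩).1, ys i e else 0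
    let F : M → ℕ → ℚ := fun m =>
      ((∏ t ∈ Ico (b + 1) m.2.1, X m.1 t) / ∏ t ∈ Ico m.2.1.val k, X m.1 t) •
        Pi.single m.2.2.val 1
    obtain ⟨s₀, z₀, hz₀, h₀⟩ := h₀ (ys b) F
    refine ⟨fun o => s₀ o.2 + s₁ o.1, fun o => Function.update (zs₁ o.1) b (z₀ o.2), ?_, ?_⟩
    · rintro o i
      by_cases hi : i = b
      · subst hi
        simpa using (hz₀ o.2).trans (finiteSums_mono (le_max_left _ _) _)
      · simpa [hi] using (hz₁ o.1 i).trans (finiteSums_mono (le_max_right _ _) _)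
    intro w
    obtain ⟨o₀, ho₀⟩ := h₀ (fun v => (o₁ v, fun p : T =>
      c ((∏ t ∈ Ico p.2.1.val k, X p.1 t) * ∑ h ∈ p.2.2.1, (v + s₁ (o₁ v)) h))) w
    refine ⟨(o₁ (w + s₀ o₀), o₀), fun x hx => ?_⟩
    have hxb : x b ∈ finiteSums r (z₀ o₀) := by simpa using hx b (by omega) (by omega)
    have hx' : ∀ i, b + 1 ≤ i → i < k →
        x i ∈ finiteSums r (zs₁ (o₁ (w + s₀ o₀)) i) := by
      intro i hi hik
      have := hx i (by omega) hik
      simpa [show i ≠ b by omega] using this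
    have hkd : k - d = b + 1 := by omega
    have hkd' : k - (d + 1) = b := by omega
    rw [hkd] at ho₁
    rw [hkd']
    intro i j hi hij hjk u hu
    rcases hi.eq_or_lt with rfl | hi
    swap
    · have := ho₁ _ x hx' i j hi hij hjk u
      rw [add_assoc] at this
      exact this hu
    have hmem : ∀ i, b + 1 ≤ i → i < k → x i ∈ finiteSums R₁ (ys i) :=
      fun i h1 h2 => hz₁ _ _ (hx' i h1 h2)
    have hidx : ∀ i : Fin k, ∃ H : (range R₁).powerset,
        b + 1 ≤ i.val → x i = ∑ e ∈ H.1, ys i e := by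
      intro i
      by_cases h : b + 1 ≤ i.val
      · obtain ⟨H, -, hH, hs⟩ := hmem i h i.2
        exact ⟨⟨H, mem_powerset.2 hH⟩, fun _ => hs⟩
      · exact ⟨⟨∅, by simp⟩, fun h' => absurd h' h⟩
    choose idx hidx using hidx
    have hX : ∀ i, b + 1 ≤ i → i < k → X idx i = x i := by
      intro i h1 h2
      simp only [X, dif_pos h2]
      exact (hidx ⟨i, h2⟩ h1).symm
    have hq : ∏ t ∈ Ico j k, X idx t = ∏ t ∈ Ico j k, x t :=
      prod_congr rfl fun t ht => by
        have := mem_Ico.1 ht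
        exact hX t (by omega) (by omega)
    have hp : ∏ t ∈ Ico (b + 1) j, X idx t = ∏ t ∈ Ico (b + 1) j, x t :=
      prod_congr rfl fun t ht => by
        have := mem_Ico.1 ht
        exact hX t (by omega) (by omega)
    have hq0 : ∏ t ∈ Ico j k, x t ≠ 0 := by
      refine prod_ne_zero_iff.2 fun t ht => ?_
      have := mem_Ico.1 ht
      exact hys t _ (finiteSums_mono (le_max_right _ _) _ (hmem t (by omega) (by omega)))
    obtain ⟨H, ⟨h, hh⟩, hH, rfl⟩ := hu
    have hcol := ho₀ _ hxb (idx, ⟨j, by omega⟩, ⟨h, mem_range.1 (hH hh)⟩)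
    rw [Prod.mk.injEq] at hcol
    obtain ⟨ho, hcol⟩ := hcol
    have hcol := congrFun hcol (idx, ⟨j, by omega⟩, ⟨H, mem_powerset.2 hH⟩)
    rw [ho] at hcol
    simp only [F, hq, hp] at hcol
    have hsum : ∑ t ∈ H, (Pi.single h 1 : ℕ → ℚ) t = 1 := by
      simp [Pi.single_apply, hh]
    have hE : (∏ t ∈ Ico j k, x t) * ∑ t ∈ H, (w + s₀ o₀ + x b •
        ((∏ t ∈ Ico (b + 1) j, x t) / ∏ t ∈ Ico j k, x t) • (Pi.single h 1 : ℕ → ℚ) +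
          s₁ (o₁ (w + s₀ o₀))) t =
        (∏ t ∈ Ico j k, x t) * ∑ t ∈ H, (w + (s₀ o₀ + s₁ (o₁ (w + s₀ o₀)))) t +
          ∏ t ∈ Ico b j, x t := by
      simp only [Pi.add_apply, Pi.smul_apply, smul_eq_mul, sum_add_distrib, ← mul_sum, hsum]
      rw [prod_eq_prod_Ico_succ_bot hij]
      field_simp
      ring
    rw [hE, add_assoc w] at hcol
    exact hcol.symm

lemma exists_compatible {κ : Type} [Finite κ] (c : ℚ → κ)
    (hc : ∀ x y, c x = c y → (x = 0 ↔ y = 0)) (k : ℕ) : ∀ r, ∃ ys : ℕ → ℕ → ℚ,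
      (∀ i, ∀ x ∈ finiteSums r (ys i), x ≠ 0) ∧
      ∀ x : ℕ → ℚ, (∀ i, i < k + 1 → x i ∈ finiteSums r (ys i)) →
        ∀ i j l, i < j → j ≤ l → l < k + 1 →
          c (∏ t ∈ Ico j (l + 1), x t) = c (∏ t ∈ Ico j (l + 1), x t + ∏ t ∈ Ico i j, x t) := by
  induction k with
  | zero =>
    refine fun r => ⟨1, ?_, fun x _ i j l h1 h2 h3 => by omega⟩
    rintro i x ⟨H, hH, -, rfl⟩
    simpa using hH.ne_empty
  | succ k ih =>
    intro r
    obtain ⟨R, O, _, hlevel⟩ := exists_topCompatible c (k + 1) r (k + 1) le_rfl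
    obtain ⟨ys, hys, hcomp⟩ := ih R
    obtain ⟨s, zs, hzs, h⟩ := hlevel ys hys
    obtain ⟨o, ho⟩ := h 0
    rw [Nat.sub_self, zero_add] at ho
    have hzs0 : ∀ i, ∀ x ∈ finiteSums r (zs o i), x ≠ 0 := fun i x hx => hys i x (hzs o i hx)
    have hs0 : ∀ u ∈ finiteSums r (s o), u ≠ 0 := by
      rintro u hu rfl
      rcases r.eq_zero_or_pos with rfl | hr
      · obtain ⟨H, hH, hH', -⟩ := hu
        exact hH.ne_empty (by simpa using hH')
      have hmem : ∀ i, zs o i 0 ∈ finiteSums r (zs o i) := fun i =>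
        ⟨{0}, singleton_nonempty 0, by simpa using hr, by simp⟩
      have h0 := hc _ _ (ho (fun i => zs o i 0) (fun i _ _ => hmem i) 0 (k + 1) le_rfl
        k.succ_pos le_rfl 0 hu)
      simp only [mul_zero, zero_add, true_iff] at h0
      exact prod_ne_zero_iff.2 (fun i _ => hzs0 i _ (hmem i)) h0
    refine ⟨Function.update (zs o) (k + 1) (s o), fun i => ?_, fun x hx i j l hij hjl hl => ?_⟩
    · by_cases hi : i = k + 1
      · subst hi
        simpa using hs0
      · simpa [hi] using hzs0 i
    have hx' : ∀ i, i < k + 1 → x i ∈ finiteSums r (zs o i) := by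
      intro i hi
      simpa [hi.ne] using hx i (by omega)
    rcases (Nat.lt_succ_iff.1 hl).eq_or_lt with rfl | hl
    · have hu : x (k + 1) ∈ finiteSums r (s o) := by simpa using hx (k + 1) (by omega)
      rcases hjl.eq_or_lt with rfl | hjl
      · simpa using ho x (fun i _ hi => hx' i hi) i (k + 1) i.zero_le hij le_rfl _ hu
      · rw [prod_Ico_succ_top (by omega)]
        exact ho x (fun i _ hi => hx' i hi) i j i.zero_le hij (by omega) _ hu
    · exact hcomp x (fun i hi => hzs o i (hx' i hi)) i j l hij hjl hl

/-- Ramsey's theorem for triangles. -/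
lemma exists_mono_triangle {κ : Type} [DecidableEq κ] (C : Finset κ) :
    ∃ N : ℕ, ∀ (S : Finset ℕ) (f : ℕ → ℕ → κ), N ≤ #S →
      (∀ i ∈ S, ∀ j ∈ S, i < j → f i j ∈ C) →
      ∃ i ∈ S, ∃ j ∈ S, ∃ k ∈ S, i < j ∧ j < k ∧ f i j = f i k ∧ f j k = f i k := by
  induction hn : #C generalizing C with
  | zero =>
    refine ⟨2, fun S f hS hf => ?_⟩
    obtain ⟨a, ha, b, hb, hab⟩ := one_lt_card.1 hS
    rw [card_eq_zero.1 hn] at hf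
    rcases lt_or_gt_of_ne hab with h | h
    · simpa using hf a ha b hb h
    · simpa using hf b hb a ha h
  | succ n ih =>
    have ih' : ∀ a, ∃ N : ℕ, a ∈ C → ∀ (S : Finset ℕ) (f : ℕ → ℕ → κ), N ≤ #S →
        (∀ i ∈ S, ∀ j ∈ S, i < j → f i j ∈ C.erase a) →
        ∃ i ∈ S, ∃ j ∈ S, ∃ k ∈ S, i < j ∧ j < k ∧ f i j = f i k ∧ f j k = f i k := by
      intro a
      by_cases ha : a ∈ C
      · obtain ⟨N, hN⟩ := ih (C.erase a) (by rw [card_erase_of_mem ha, hn]; rfl)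
        exact ⟨N, fun _ => hN⟩
      · exact ⟨0, fun h => absurd h ha⟩
    choose N hN using ih'
    refine ⟨(∑ a ∈ C, N a) + 2, fun S f hS hf => ?_⟩
    have hne : S.Nonempty := card_pos.1 (by omega)
    set m := S.min' hne
    have hmS : m ∈ S := S.min'_mem hne
    have hlt : ∀ j ∈ S.erase m, m < j := fun j hj => S.min'_lt_of_mem_erase_min' hne hj
    have hcard : #(S.erase m) = ∑ a ∈ C, #{j ∈ S.erase m | f m j = a} :=
      card_eq_sum_card_fiberwise fun j hj => hf m hmS j (mem_of_mem_erase hj) (hlt j hj)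
    obtain ⟨a, ha, hNa⟩ : ∃ a ∈ C, N a ≤ #{j ∈ S.erase m | f m j = a} := by
      by_contra! h
      have := sum_le_sum fun a ha => (h a ha).le
      rw [← hcard, card_erase_of_mem hmS] at this
      omega
    set S' := {j ∈ S.erase m | f m j = a}
    have hS' : ∀ j ∈ S', j ∈ S ∧ m < j ∧ f m j = a := fun j hj => by
      obtain ⟨h1, h2⟩ := mem_filter.1 hj
      exact ⟨mem_of_mem_erase h1, hlt j h1, h2⟩
    by_cases h : ∃ i ∈ S', ∃ j ∈ S', i < j ∧ f i j = a
    · obtain ⟨i, hi, j, hj, hij, hfa⟩ := h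
      obtain ⟨hi1, hi2, hi3⟩ := hS' i hi
      obtain ⟨hj1, hj2, hj3⟩ := hS' j hj
      exact ⟨m, hmS, i, hi1, j, hj1, hi2, hij, hi3.trans hj3.symm, hfa.trans hj3.symm⟩
    · push Not at h
      obtain ⟨i, hi, j, hj, l, hl, H⟩ := hN a ha S' f hNa fun i hi j hj hij =>
        mem_erase.2 ⟨h i hi j hj hij, hf i (hS' i hi).1 j (hS' j hj).1 hij⟩
      exact ⟨i, (hS' i hi).1, j, (hS' j hj).1, l, (hS' l hl).1, H⟩

/-- For any coloring of the rational numbers into finitely many colors, there exist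
nonzero rationals `x` and `y` such that `{x, y, x*y, x+y}` is monochromatic. -/
theorem hindman_quadruple (n : ℕ) (c : ℚ → Fin n) :
    ∃ x y : ℚ, x ≠ 0 ∧ y ≠ 0 ∧ c y = c x ∧ c (x * y) = c x ∧ c (x + y) = c x := by
  obtain ⟨N, hN⟩ := exists_mono_triangle (univ : Finset (Fin n))
  obtain ⟨ys, hys, hcomp⟩ := exists_compatible (fun x => (c x, decide (x = 0)))
    (fun x y h => by simpa using congrArg Prod.snd h) N 1
  have hmem : ∀ i, ys i 0 ∈ finiteSums 1 (ys i) := fun i =>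
    ⟨{0}, singleton_nonempty 0, by simp, by simp⟩
  have hne : ∀ i j, ∏ t ∈ Ico i j, ys t 0 ≠ 0 := fun i j =>
    prod_ne_zero_iff.2 fun t _ => hys t _ (hmem t)
  obtain ⟨i, -, j, -, k, hk, hij, hjk, h1, h2⟩ :=
    hN (range N) (fun i j => c (∏ t ∈ Ico i j, ys t 0)) (by simp) (by simp)
  have h3 := congrArg Prod.fst <| hcomp (fun t => ys t 0) (fun i _ => hmem i) i j (k - 1) hij
    (by omega) (by have := mem_range.1 hk; omega)
  rw [Nat.sub_add_cancel (by omega)] at h3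
  refine ⟨∏ t ∈ Ico j k, ys t 0, ∏ t ∈ Ico i j, ys t 0, hne _ _, hne _ _, h1.trans h2.symm, ?_,
    h3.symm⟩
  rw [mul_comm, prod_Ico_consecutive _ hij.le hjk.le]
  exact h2.symm
end

section
/- For any coloring of the rational numbers into finitely many colors, there exists a nonzero rational y and infinitely many rationals x such that the set {x, y, x*y, x + y} is monochromatic (where the common color may depend on x). -/
open Filter

/-- The colors that `c` gives to the dilates of `u` by the elements of `F`. -/
def dilationPattern {n : ℕ} (c : ℚ → Fin n) (F : Finset ℚ) (u : ℚ) : F → Fin n :=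
  fun f => c (u * f)

/-- A set `J` of colors is multiplicatively thick for `c` if every finite set of nonzero
rationals has a dilate all of whose elements have their colors in `J`. -/
def IsMulThick {n : ℕ} (c : ℚ → Fin n) (J : Set (Fin n)) : Prop :=
  ∀ G : Finset ℚ, (∀ g ∈ G, g ≠ 0) → ∃ e : ℚ, e ≠ 0 ∧ ∀ g ∈ G, c (e * g) ∈ J

/-- For every auxiliary coloring `ψ` and every affine reparametrization and finite set of scales
depending on the color under `ψ`, one can move a point by a bounded amount and find a multiplier
`g` in a finite set, chosen independently of the parametrization, such that the dilation pattern
at `g` is not in `X` while `ψ` does not change under translation by `g` times the scales. -/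
def CanAvoid {n : ℕ} (c : ℚ → Fin n) (F : Finset ℚ) (X : Finset (F → Fin n)) : Prop :=
  ∀ (S T : Type) [Finite S] [Finite T], ∃ (G : Finset ℚ) (I : Type) (_ : Finite I),
    (∀ g ∈ G, g ≠ 0) ∧
    ∀ (R : S → ℚ) (δ : S → ℚ) (Λ : S → T → ℚ), (∀ s, R s ≠ 0) → ∃ D : I → ℚ, ∀ ψ : ℚ → S,
      ∀ᶠ x in cofinite, ∃ p : I × G,
        dilationPattern c F ((x + D p.1 + δ (ψ (x + D p.1))) * R (ψ (x + D p.1)) * p.2) ∉ X ∧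
        ∀ τ, ψ (x + D p.1 + Λ (ψ (x + D p.1)) τ * p.2) = ψ (x + D p.1)

theorem exists_finset_forall_isMulThick_range {n : ℕ} (c : ℚ → Fin n) :
    ∃ F : Finset ℚ, (∀ f ∈ F, f ≠ 0) ∧
      ∀ u : ℚ, u ≠ 0 → IsMulThick c (Set.range (dilationPattern c F u)) := by
  classical
  have key : ∀ J : Set (Fin n), ∃ G : Finset ℚ, (∀ g ∈ G, g ≠ 0) ∧
      (¬ IsMulThick c J → ∀ e : ℚ, e ≠ 0 → ∃ g ∈ G, c (e * g) ∉ J) := by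
    intro J
    by_cases hJ : IsMulThick c J
    · exact ⟨∅, by simp, fun h => absurd hJ h⟩
    · have h := hJ
      unfold IsMulThick at h
      push Not at h
      obtain ⟨G, hG, h⟩ := h
      exact ⟨G, hG, fun _ => h⟩
  choose G hG0 hG using key
  refine ⟨Finset.univ.biUnion G, ?_, ?_⟩
  · intro f hf
    obtain ⟨J, -, hJ⟩ := Finset.mem_biUnion.1 hf
    exact hG0 J f hJ
  · intro u hu
    by_contra hthick
    obtain ⟨g, hg, hgc⟩ := hG _ hthick u hu
    exact hgc ⟨⟨g, Finset.mem_biUnion.2 ⟨_, Finset.mem_univ _, hg⟩⟩, rfl⟩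

theorem canAvoid_empty {n : ℕ} (c : ℚ → Fin n) (F : Finset ℚ) : CanAvoid c F ∅ := by
  intro S T _ _
  obtain ⟨ι, _, hι⟩ := Combinatorics.Line.exists_mono_in_high_dimension (Option (S × T)) S
  refine ⟨(Finset.Icc 1 (Fintype.card ι)).image (fun k : ℕ => (k : ℚ)), ι → Option (S × T),
    inferInstance, ?_, ?_⟩
  · intro g hg
    obtain ⟨k, hk, rfl⟩ := Finset.mem_image.1 hg
    have := (Finset.mem_Icc.1 hk).1
    positivity
  intro R δ Λ _
  set val : Option (S × T) → ℚ := fun o => o.elim 0 (fun p => Λ p.1 p.2) with hval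
  refine ⟨fun v => ∑ i, val (v i), fun ψ => Eventually.of_forall fun x => ?_⟩
  obtain ⟨l, s, hl⟩ := hι (fun v => ψ (x + ∑ i, val (v i)))
  set a : ℕ := (Finset.univ.filter fun i => l.idxFun i = none).card with ha
  have hsum : ∀ o, ∑ i, val (l o i) = ∑ i, val (l none i) + val o * a := by
    intro o
    have h1 : ∀ i, val (l o i) = val (l none i) + if l.idxFun i = none then val o else 0 := by
      intro i
      rcases h : l.idxFun i with _ | b
      · simp [h, hval]
      · simp [h]
    rw [Finset.sum_congr rfl fun i _ => h1 i, Finset.sum_add_distrib, ← Finset.sum_filter,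
      Finset.sum_const, nsmul_eq_mul, mul_comm (a : ℚ)]
  have ha1 : 1 ≤ a := by
    obtain ⟨i, hi⟩ := l.proper
    exact Finset.card_pos.2 ⟨i, by simp [hi]⟩
  have ha2 : a ≤ Fintype.card ι := Finset.card_le_univ _
  have hs : ψ (x + ∑ i, val (l none i)) = s := hl none
  refine ⟨(l none, ⟨a, Finset.mem_image.2 ⟨a, Finset.mem_Icc.2 ⟨ha1, ha2⟩, rfl⟩⟩),
    by simp, fun τ => ?_⟩
  have h2 := hl (some (s, τ))
  simp only [hsum (some (s, τ))] at h2
  simp only [hs]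
  rw [add_assoc]
  exact h2

theorem eventually_cofinite_affine {p : ℚ → Prop} (hp : ∀ᶠ x in cofinite, p x) (a : ℚ) {b : ℚ}
    (hb : b ≠ 0) : ∀ᶠ x in cofinite, p ((x + a) * b) := by
  have hinj : Function.Injective fun x : ℚ => (x + a) * b := by
    intro x y hxy
    exact add_right_cancel (mul_right_cancel₀ hb hxy)
  exact hinj.tendsto_cofinite.eventually hp

theorem CanAvoid.insert_of_not_isMulThick {n : ℕ} {c : ℚ → Fin n} {F : Finset ℚ}
    (hF : ∀ u : ℚ, u ≠ 0 → IsMulThick c (Set.range (dilationPattern c F u)))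
    {X : Finset (F → Fin n)} (hX : CanAvoid c F X) {χ : F → Fin n}
    (hχ : ¬ IsMulThick c (Set.range χ)) : CanAvoid c F (insert χ X) := by
  intro S T _ _
  obtain ⟨G, I, hI, hG, h⟩ := hX S T
  refine ⟨G, I, hI, hG, fun R δ Λ hR => ?_⟩
  obtain ⟨D, hD⟩ := h R δ Λ hR
  refine ⟨D, fun ψ => ?_⟩
  have hne : ∀ᶠ x in cofinite, ∀ (i : I) (s : S), (x + (D i + δ s)) * 1 ≠ 0 := by
    refine eventually_all.2 fun i => eventually_all.2 fun s => ?_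
    exact eventually_cofinite_affine (p := fun z => z ≠ 0) (eventually_cofinite_ne 0) _ one_ne_zero
  filter_upwards [hD ψ, hne] with x ⟨p, hp, hret⟩ hx
  refine ⟨p, ?_, hret⟩
  rw [Finset.mem_insert, not_or]
  refine ⟨fun heq => hχ ?_, hp⟩
  rw [← heq]
  refine hF _ (mul_ne_zero (mul_ne_zero ?_ (hR _)) (hG _ p.2.2))
  simpa [add_assoc] using hx p.1 (ψ (x + D p.1))

theorem CanAvoid.insert_of_isMulThick {n : ℕ} {c : ℚ → Fin n}
    (hc : ∀ y : ℚ, y ≠ 0 → ∀ᶠ x in cofinite,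
      ¬ (c y = c x ∧ c (x * y) = c x ∧ c (x + y) = c x))
    {F : Finset ℚ} (hF : ∀ f ∈ F, f ≠ 0)
    {X : Finset (F → Fin n)} (hX : CanAvoid c F X) {χ : F → Fin n}
    (hχ : IsMulThick c (Set.range χ)) : CanAvoid c F (insert χ X) := by
  classical
  intro S T _ _
  obtain ⟨G₁, I₁, _, hG₁, h₁⟩ := hX S T
  obtain ⟨G₂, I₂, _, hG₂, h₂⟩ := hX (I₁ × G₁ × S × (F → Fin n)) (T ⊕ F)
  obtain ⟨e, he, heG⟩ := hχ G₂ hG₂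
  refine ⟨G₁ ∪ (G₁ ×ˢ G₂).image (fun q => q.1 * e * q.2), I₁ × I₂, inferInstance, ?_, ?_⟩
  · intro g hg
    rcases Finset.mem_union.1 hg with hg | hg
    · exact hG₁ g hg
    · obtain ⟨q, hq, rfl⟩ := Finset.mem_image.1 hg
      rw [Finset.mem_product] at hq
      exact mul_ne_zero (mul_ne_zero (hG₁ _ hq.1) he) (hG₂ _ hq.2)
  intro R δ Λ hR
  obtain ⟨D₁, hD₁⟩ := h₁ R δ Λ hR
  obtain ⟨D₂, hD₂⟩ := h₂ (fun t => R t.2.2.1 * t.2.1 * e) (fun t => D₁ t.1 + δ t.2.2.1)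
    (fun t => Sum.elim (fun τ => Λ t.2.2.1 τ * t.2.1 * e) (fun f => e / (R t.2.2.1 * t.2.1 * f)))
    (fun t => mul_ne_zero (mul_ne_zero (hR _) (hG₁ _ t.2.1.2)) he)
  refine ⟨fun i => D₂ i.2 + D₁ i.1, fun ψ => ?_⟩
  obtain ⟨Φ, hΦ⟩ := (hD₁ ψ).choice
  set Ψ : ℚ → I₁ × G₁ × S × (F → Fin n) := fun x =>
    ((Φ x).1, (Φ x).2, ψ (x + D₁ (Φ x).1), dilationPattern c F
      ((x + D₁ (Φ x).1 + δ (ψ (x + D₁ (Φ x).1))) * R (ψ (x + D₁ (Φ x).1)) * (Φ x).2)) with hΨ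
  have hΦ' : ∀ᶠ x in cofinite, ∀ i₂ : I₂, _ :=
    eventually_all.2 fun i₂ => eventually_cofinite_affine hΦ (D₂ i₂) one_ne_zero
  have hc' : ∀ᶠ x in cofinite, ∀ (i₂ : I₂) (i₁ : I₁) (s : S) (g₁ : G₁) (f : F) (g₂ : G₂), _ :=
    eventually_all.2 fun i₂ => eventually_all.2 fun i₁ => eventually_all.2 fun s =>
      eventually_all.2 fun g₁ => eventually_all.2 fun f => eventually_all.2 fun g₂ =>
        eventually_cofinite_affine (hc (e * g₂) (mul_ne_zero he (hG₂ _ g₂.2)))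
          (D₂ i₂ + D₁ i₁ + δ s)
          (mul_ne_zero (mul_ne_zero (hR s) (hG₁ _ g₁.2)) (hF _ f.2))
  filter_upwards [hD₂ Ψ, hΦ', hc'] with x ⟨⟨i₂, g₂⟩, hpat, hret⟩ hx hxc
  have hx := hx i₂
  rw [mul_one] at hx
  simp only at hpat hret
  set y := x + D₂ i₂ with hy
  set i₁ := (Φ y).1 with hi₁
  set g₁ := (Φ y).2 with hg₁
  set s := ψ (y + D₁ i₁) with hs
  set u := (y + D₁ i₁ + δ s) * R s * g₁ with hu
  have hΨy : Ψ y = (i₁, g₁, s, dilationPattern c F u) := rfl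
  rw [hΨy] at hpat hret
  simp only at hpat hret
  have hxy : x + (D₂ i₂ + D₁ i₁) = y + D₁ i₁ := by rw [hy]; ring
  have hstable : ∀ z, Ψ z = (i₁, g₁, s, dilationPattern c F u) →
      ψ (z + D₁ i₁) = s ∧
        dilationPattern c F ((z + D₁ i₁ + δ s) * R s * g₁) = dilationPattern c F u := by
    intro z hz
    simp only [hΨ, Prod.mk.injEq] at hz
    obtain ⟨h1, h2, h3, h4⟩ := hz
    rw [h1] at h3 h4
    rw [h3, h2] at h4
    exact ⟨h3, h4⟩
  by_cases hχu : dilationPattern c F u = χ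
  · have hu2 : (y + (D₁ i₁ + δ s)) * (R s * g₁ * e) * g₂ = u * (e * g₂) := by
      rw [hu]; ring
    rw [hu2] at hpat
    by_cases hχu2 : dilationPattern c F (u * (e * g₂)) = χ
    · exfalso
      obtain ⟨f, hf⟩ := heG g₂ g₂.2
      have hfne : (f : ℚ) ≠ 0 := hF _ f.2
      have hgne : (g₁ : ℚ) ≠ 0 := hG₁ _ g₁.2
      have hshift := (hstable _ (hret (Sum.inr f))).2
      simp only [Sum.elim_inr] at hshift
      have e1 : (x + (D₂ i₂ + D₁ i₁ + δ s)) * (R s * g₁ * f) = u * f := by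
        rw [hu, hy]; ring
      have hno := hxc i₂ i₁ s g₁ f g₂
      rw [e1] at hno
      have c1 : c (u * f) = χ f := congrFun hχu f
      have c2 : c (u * f * (e * g₂)) = χ f := by
        rw [← congrFun hχu2 f]
        unfold dilationPattern
        congr 1
        ring
      have c3 : c (u * f + e * g₂) = χ f := by
        rw [← congrFun (hshift.trans hχu) f]
        unfold dilationPattern
        congr 1
        have := hR s
        rw [hu]
        field_simp
        ring
      exact hno ⟨by rw [c1, hf], by rw [c1, c2], by rw [c1, c3]⟩
    · refine ⟨((i₁, i₂), ⟨g₁ * e * g₂, Finset.mem_union_right _ (Finset.mem_image.2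
        ⟨(g₁, g₂), Finset.mem_product.2 ⟨g₁.2, g₂.2⟩, rfl⟩)⟩), ?_, ?_⟩
      · simp only [hxy, ← hs]
        have e2 : (y + D₁ i₁ + δ s) * R s * (g₁ * e * g₂) = u * (e * g₂) := by
          rw [hu]; ring
        rw [e2, Finset.mem_insert, not_or]
        exact ⟨hχu2, hpat⟩
      · intro τ
        simp only [hxy, ← hs]
        have hshift := (hstable _ (hret (Sum.inl τ))).1
        simp only [Sum.elim_inl] at hshift
        rw [← hshift]
        congr 1
        rw [hshift]
        ring
  · refine ⟨((i₁, i₂), ⟨g₁, Finset.mem_union_left _ g₁.2⟩), ?_, ?_⟩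
    · simp only [hxy, ← hs]
      rw [Finset.mem_insert, not_or]
      exact ⟨hχu, hx.1⟩
    · intro τ
      simp only [hxy]
      exact hx.2 τ

/-- For any coloring of the rationals into finitely many colors, there exists a nonzero
rational `y` and infinitely many rationals `x` such that `{x, y, x*y, x+y}` is
monochromatic (the common color may depend on `x`). -/
theorem hindman_quadruple_infinitely_many (n : ℕ) (c : ℚ → Fin n) :
    ∃ y : ℚ, y ≠ 0 ∧
      {x : ℚ | c y = c x ∧ c (x * y) = c x ∧ c (x + y) = c x}.Infinite := by
  by_contra! hfin
  have hc : ∀ y : ℚ, y ≠ 0 → ∀ᶠ x in cofinite,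
      ¬ (c y = c x ∧ c (x * y) = c x ∧ c (x + y) = c x) := by
    intro y hy
    have := hfin y hy
    simpa [Filter.eventually_cofinite] using this
  obtain ⟨F, hF0, hF⟩ := exists_finset_forall_isMulThick_range c
  have hall : ∀ X : Finset (F → Fin n), CanAvoid c F X := by
    intro X
    induction X using Finset.induction_on with
    | empty => exact canAvoid_empty c F
    | insert χ X _ ih =>
      by_cases hχ : IsMulThick c (Set.range χ)
      · exact ih.insert_of_isMulThick hc hF0 hχ
      · exact ih.insert_of_not_isMulThick hF hχ
  obtain ⟨G, I, _, -, h⟩ := hall Finset.univ Unit Unit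
  obtain ⟨D, hD⟩ := h (fun _ => 1) (fun _ => 0) (fun _ _ => 0) (fun _ => one_ne_zero)
  obtain ⟨x, p, hp, -⟩ := (hD fun _ => ()).exists
  exact hp (Finset.mem_univ _)
end

section
/- For any coloring of the rational numbers into finitely many colors, there exist nonzero rationals x and y such that the four numbers x, y, x*y, x + y are pairwise distinct and the set {x, y, x*y, x + y} is monochromatic. -/
open Filter
open scoped Pointwise

/-- The nonempty subset sums of a finite family of rationals. -/
def subsetSums {n : ℕ} (A : Fin n → ℚ) : Finset ℚ :=
  (Finset.univ.filter fun H : Finset (Fin n) => H.Nonempty).image fun H => ∑ i ∈ H, A i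

lemma mem_subsetSums {n : ℕ} {A : Fin n → ℚ} {b : ℚ} :
    b ∈ subsetSums A ↔ ∃ H : Finset (Fin n), H.Nonempty ∧ ∑ i ∈ H, A i = b := by
  simp [subsetSums]

lemma card_subsetSums_le {n : ℕ} (A : Fin n → ℚ) : (subsetSums A).card ≤ 2 ^ n := by
  refine Finset.card_image_le.trans ((Finset.card_filter_le _ _).trans ?_)
  simp

lemma subsetSums_comp_subset {m n : ℕ} (A : Fin n → ℚ) (e : Fin m ↪ Fin n) :
    subsetSums (A ∘ e) ⊆ subsetSums A := by
  intro b hb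
  obtain ⟨H, hH, rfl⟩ := mem_subsetSums.1 hb
  exact mem_subsetSums.2 ⟨H.map e, hH.map, by simp⟩

/-- Multidimensional Hales–Jewett for one family of rationals. -/
lemma exists_subsetSums_mono (n : ℕ) (τ κ : Type) [Finite τ] [Finite κ] :
    ∃ (N : ℕ) (υ : Type), Finite υ ∧ ∀ (B : Fin N → ℚ) (T : τ → ℚ), ∃ U : υ → ℚ,
      ∀ (f : ℚ → κ) (x₀ : ℚ), ∃ (u : υ) (B' : Fin n → ℚ), subsetSums B' ⊆ subsetSums B ∧
        ∀ b ∈ subsetSums B', ∀ t, f (x₀ + U u + T t * b) = f (x₀ + U u) := by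
  classical
  obtain ⟨N, hN⟩ :=
    Combinatorics.Subspace.exists_mono_in_high_dimension_fin (Option τ) κ (Fin n)
  refine ⟨N, Fin N → Option τ, inferInstance, fun B T => ?_⟩
  let U : (Fin N → Option τ) → ℚ := fun w => ∑ i, (w i).elim 0 T * B i
  refine ⟨U, fun f x₀ => ?_⟩
  obtain ⟨l, c₀, hl⟩ := hN fun w => f (x₀ + U w)
  let S : Fin n → Finset (Fin N) := fun h => Finset.univ.filter fun i => l.idxFun i = Sum.inr h
  have hsum : ∀ H : Finset (Fin n),
      ∑ h ∈ H, ∑ i ∈ S h, B i = ∑ i ∈ H.biUnion S, B i := by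
    intro H
    rw [Finset.sum_biUnion]
    intro h _ h' _ hne
    rw [Function.onFun, Finset.disjoint_left]
    intro i hi hi'
    simp only [S, Finset.mem_filter, Finset.mem_univ, true_and] at hi hi'
    exact hne (Sum.inr.inj (hi.symm.trans hi'))
  refine ⟨l fun _ => none, fun h => ∑ i ∈ S h, B i, ?_, ?_⟩
  · intro b hb
    obtain ⟨H, ⟨h, hh⟩, rfl⟩ := mem_subsetSums.1 hb
    obtain ⟨i, hi⟩ := l.proper h
    exact mem_subsetSums.2 ⟨H.biUnion S, ⟨i, Finset.mem_biUnion.2 ⟨h, hh, by simp [S, hi]⟩⟩,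
      (hsum H).symm⟩
  · intro b hb t
    obtain ⟨H, -, rfl⟩ := mem_subsetSums.1 hb
    have key : U (l fun h => if h ∈ H then some t else none) =
        U (l fun _ => none) + T t * ∑ h ∈ H, ∑ i ∈ S h, B i := by
      rw [hsum, ← Finset.filter_univ_mem (H.biUnion S), Finset.sum_filter, Finset.mul_sum, ← Finset.sum_add_distrib]
      refine Finset.sum_congr rfl fun i _ => ?_
      rcases hi : l.idxFun i with a | h
      · simp [l.apply_inl hi, S, hi]
      · by_cases hH : h ∈ H <;> simp [l.apply_inr hi, S, hi, hH]
    have h1 := hl fun h => if h ∈ H then some t else none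
    have h2 := hl fun _ => none
    simp only [key] at h1 h2
    rw [add_assoc, h1, h2]

/-- Products of at most one subset sum from each family in the list. -/
def words {n : ℕ} : List (Fin n → ℚ) → Finset ℚ
  | [] => {1}
  | A :: L => words L ∪ words L * subsetSums A

/-- The colour of every product `s * x` with `s` a word in the families below is unchanged by adding
to it a word times a subset sum of the next family. -/
def AbsorbsSums {n : ℕ} {κ : Type} (c : ℚ → κ) : List (Fin n → ℚ) → ℚ → Prop
  | [], _ => True
  | B :: L, x => AbsorbsSums c L x ∧ ∀ b ∈ subsetSums B, ∀ s ∈ words L, ∀ t ∈ words L,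
      c (s * x + t * b) = c (s * x)

/-- Each subset sum of a family absorbs all the earlier families. -/
def Coherent {n : ℕ} {κ : Type} (c : ℚ → κ) : List (Fin n → ℚ) → Prop
  | [] => True
  | A :: L => Coherent c L ∧ ∀ a ∈ subsetSums A, AbsorbsSums c L a

/-- The families of the first list have their subset sums among those of the corresponding families
of the second. -/
def Subsystem {m n : ℕ} : List (Fin m → ℚ) → List (Fin n → ℚ) → Prop :=
  List.Forall₂ fun B' B => subsetSums B' ⊆ subsetSums B

/-- No family in the list has a vanishing nonempty subset sum. -/
def SumsNeZero {n : ℕ} (L : List (Fin n → ℚ)) : Prop := ∀ A ∈ L, (0 : ℚ) ∉ subsetSums A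

namespace Subsystem

variable {m n : ℕ} {L' : List (Fin m → ℚ)} {L : List (Fin n → ℚ)}

lemma words_subset (h : Subsystem L' L) : words L' ⊆ words L := by
  induction h with
  | nil => simp [words]
  | cons h _ ih => exact Finset.union_subset_union ih (Finset.mul_subset_mul ih h)

lemma absorbsSums {κ : Type} {c : ℚ → κ} {x : ℚ} (h : Subsystem L' L) (hx : AbsorbsSums c L x) :
    AbsorbsSums c L' x := by
  induction h with
  | nil => trivial
  | cons h h' ih =>
    exact ⟨ih hx.1, fun b hb s hs t ht => hx.2 b (h hb) s (words_subset h' hs) t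
      (words_subset h' ht)⟩

lemma coherent {κ : Type} {c : ℚ → κ} (h : Subsystem L' L) (hL : Coherent c L) :
    Coherent c L' := by
  induction h with
  | nil => exact hL
  | cons h h' ih => exact ⟨ih hL.1, fun a ha => absorbsSums h' (hL.2 a (h ha))⟩

lemma sumsNeZero (h : Subsystem L' L) (hL : SumsNeZero L) : SumsNeZero L' := by
  induction h with
  | nil => simp [SumsNeZero]
  | cons h h' ih =>
    simp only [SumsNeZero, List.mem_cons, forall_eq_or_imp] at hL ih ⊢
    exact ⟨fun h0 => hL.1 (h h0), ih hL.2⟩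

lemma trans {k : ℕ} {L'' : List (Fin k → ℚ)} (h' : Subsystem L'' L') (h : Subsystem L' L) :
    Subsystem L'' L := by
  induction h generalizing L'' with
  | nil => cases h'; exact .nil
  | cons h _ ih =>
    cases h' with
    | cons h1 h2 => exact .cons (h1.trans h) (ih h2)

lemma map_comp (L : List (Fin n → ℚ)) (e : Fin m ↪ Fin n) : Subsystem (L.map (· ∘ e)) L := by
  induction L with
  | nil => exact .nil
  | cons A L ih => exact .cons (subsetSums_comp_subset A e) ih

end Subsystem

lemma zero_notMem_words {n : ℕ} {L : List (Fin n → ℚ)} (hL : SumsNeZero L) : 0 ∉ words L := by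
  induction L with
  | nil => simp [words]
  | cons A L ih =>
    simp only [SumsNeZero, List.mem_cons, forall_eq_or_imp] at hL
    simp only [words, Finset.mem_union, Finset.mem_mul, not_or, not_exists, not_and]
    refine ⟨ih hL.2, fun a ha b hb hab => ?_⟩
    rcases mul_eq_zero.1 hab with rfl | rfl
    exacts [ih hL.2 ha, hL.1 hb]

lemma one_mem_words {n : ℕ} (L : List (Fin n → ℚ)) : 1 ∈ words L := by
  induction L with
  | nil => simp [words]
  | cons A L ih => exact Finset.mem_union_left _ ih

lemma card_words_le {n : ℕ} (L : List (Fin n → ℚ)) :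
    (words L).card ≤ (1 + 2 ^ n) ^ L.length := by
  induction L with
  | nil => simp [words]
  | cons A L ih =>
    calc (words (A :: L)).card ≤ (words L).card + (words L).card * (subsetSums A).card :=
          (Finset.card_union_le _ _).trans (Nat.add_le_add_left Finset.card_mul_le _)
      _ = (words L).card * (1 + (subsetSums A).card) := by ring
      _ ≤ (1 + 2 ^ n) ^ L.length * (1 + 2 ^ n) :=
          Nat.mul_le_mul ih (Nat.add_le_add_left (card_subsetSums_le A) 1)
      _ = _ := by rw [List.length_cons, pow_succ]

lemma exists_range_eq_words (n M : ℕ) : ∃ w, ∀ L : List (Fin n → ℚ), L.length = M →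
    ∃ W : Fin w → ℚ, Set.range W = words L := by
  refine ⟨(1 + 2 ^ n) ^ M, fun L hL => ?_⟩
  have hcard := hL ▸ card_words_le L
  have : Nonempty (words L) := ⟨⟨1, one_mem_words L⟩⟩
  let g : words L ↪ Fin ((1 + 2 ^ n) ^ M) :=
    (words L).equivFin.toEmbedding.trans (Fin.castLEEmb hcard)
  refine ⟨fun i => (Function.invFun g i : words L), ?_⟩
  rw [Set.range_comp', (Function.invFun_surjective g.injective).range_eq]
  simp

/-- Starting anywhere, a bounded translation makes finitely many translates absorb a subsystem. -/
lemma exists_translate_absorbsSums {κ : Type} [Finite κ] (c : ℚ → κ) (M : ℕ) :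
    ∀ (n : ℕ) (ι : Type) [Finite ι], ∃ (N : ℕ) (υ : Type), Finite υ ∧
      ∀ L : List (Fin N → ℚ), L.length = M → SumsNeZero L → ∀ H : ι → ℚ, ∃ V : υ → ℚ,
        ∀ x₀ : ℚ, ∃ (u : υ) (L' : List (Fin n → ℚ)), Subsystem L' L ∧
          ∀ i, AbsorbsSums c L' (x₀ + V u + H i) := by
  induction M with
  | zero =>
    intro n ι _
    refine ⟨0, Unit, inferInstance, fun L hL _ H => ⟨0, fun x₀ => ⟨(), [], ?_, fun _ => trivial⟩⟩⟩
    rw [List.length_eq_zero_iff.1 hL]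
    exact .nil
  | succ M ih =>
    intro n ι _
    obtain ⟨N₀, υ₀, _, h₀⟩ := ih n ι
    obtain ⟨w, hw⟩ := exists_range_eq_words N₀ M
    obtain ⟨N₁, υ₁, _, h₁⟩ :=
      exists_subsetSums_mono n (Fin w × Fin w) (Fin w × υ₀ × ι → κ)
    refine ⟨max N₀ N₁, υ₁ × υ₀, inferInstance, fun L hL hne H => ?_⟩
    obtain ⟨B, L₀, rfl⟩ := List.exists_cons_of_length_eq_add_one hL
    simp only [SumsNeZero, List.mem_cons, forall_eq_or_imp] at hne
    let e₀ : Fin N₀ ↪ Fin (max N₀ N₁) := Fin.castLEEmb (le_max_left _ _)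
    let e₁ : Fin N₁ ↪ Fin (max N₀ N₁) := Fin.castLEEmb (le_max_right _ _)
    have hsub := Subsystem.map_comp L₀ e₀
    have hlen : (L₀.map (· ∘ e₀)).length = M := by simpa using hL
    generalize L₀.map (· ∘ e₀) = L₁ at hsub hlen
    have hne₁ : SumsNeZero L₁ := hsub.sumsNeZero hne.2
    obtain ⟨V₀, hV₀⟩ := h₀ L₁ hlen hne₁ H
    obtain ⟨W, hW⟩ := hw L₁ hlen
    obtain ⟨U, hU⟩ := h₁ (B ∘ e₁) fun p => W p.2 / W p.1
    refine ⟨fun p => U p.1 + V₀ p.2, fun x₀ => ?_⟩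
    obtain ⟨u₁, B', hB', hmono⟩ := hU (fun v p => c (W p.1 * (v + V₀ p.2.1 + H p.2.2))) x₀
    obtain ⟨u₀, L', hL', habs⟩ := hV₀ (x₀ + U u₁)
    refine ⟨(u₁, u₀), B' :: L', .cons (hB'.trans (subsetSums_comp_subset B e₁))
      (hL'.trans hsub), fun i => ?_⟩
    rw [← add_assoc]
    refine ⟨habs i, fun b hb s hs t ht => ?_⟩
    have hs' : s ∈ Set.range W := hW ▸ Finset.mem_coe.2 (hL'.words_subset hs)
    have ht' : t ∈ Set.range W := hW ▸ Finset.mem_coe.2 (hL'.words_subset ht)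
    obtain ⟨a, rfl⟩ := hs'
    obtain ⟨a', rfl⟩ := ht'
    have hs0 : W a ≠ 0 := fun h =>
      zero_notMem_words hne₁ (h ▸ hL'.words_subset hs)
    have := congrFun (hmono b hb (a, a')) (a, u₀, i)
    simp only at this
    rw [← this]
    congr 1
    field_simp
    ring

lemma exists_coherent {κ : Type} [Finite κ] (c : ℚ → κ) (M : ℕ) : ∀ n : ℕ,
    ∃ L : List (Fin n → ℚ), L.length = M ∧ Coherent c L ∧ SumsNeZero L := by
  induction M with
  | zero => exact fun n => ⟨[], rfl, trivial, by simp [SumsNeZero]⟩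
  | succ M ih =>
    have key : ∀ j n : ℕ, ∃ (L : List (Fin n → ℚ)) (X : Fin j → ℚ), L.length = M ∧
        Coherent c L ∧ SumsNeZero L ∧ ∀ x ∈ subsetSums X, x ≠ 0 ∧ AbsorbsSums c L x := by
      intro j
      induction j with
      | zero =>
        intro n
        obtain ⟨L, h₁, h₂, h₃⟩ := ih n
        refine ⟨L, Fin.elim0, h₁, h₂, h₃, fun x hx => ?_⟩
        obtain ⟨H, ⟨i, -⟩, -⟩ := mem_subsetSums.1 hx
        exact i.elim0
      | succ j ihj =>
        intro n
        obtain ⟨N, υ, _, hN⟩ := exists_translate_absorbsSums c M n (Finset (Fin j))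
        obtain ⟨L, X, h₁, h₂, h₃, h₄⟩ := ihj N
        let S : Finset (Fin j) → ℚ := fun H => ∑ i ∈ H, X i
        obtain ⟨V, hV⟩ := hN L h₁ h₃ S
        obtain ⟨x₀, hx₀⟩ :=
          (Set.finite_range fun p : υ × Finset (Fin j) => -(V p.1 + S p.2)).exists_notMem
        obtain ⟨u, L', hL', habs⟩ := hV x₀
        refine ⟨L', Fin.cons (x₀ + V u) X, hL'.length_eq.trans h₁, hL'.coherent h₂,
          hL'.sumsNeZero h₃, fun x hx => ?_⟩
        obtain ⟨H, hH, rfl⟩ := mem_subsetSums.1 hx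
        let H' : Finset (Fin j) := Finset.univ.filter fun i => i.succ ∈ H
        have hsum : ∑ i ∈ H, (Fin.cons (x₀ + V u) X : Fin (j + 1) → ℚ) i =
            (if 0 ∈ H then x₀ + V u else 0) + S H' := by
          rw [← Finset.filter_univ_mem H, Finset.sum_filter, Fin.sum_univ_succ]
          simp [S, H', Finset.sum_filter]
        rw [hsum]
        by_cases h0 : 0 ∈ H
        · rw [if_pos h0]
          exact ⟨fun h => hx₀ ⟨(u, H'), by simp only; linarith⟩, habs H'⟩
        · rw [if_neg h0, zero_add]
          have hmem : S H' ∈ subsetSums X := by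
            obtain ⟨i, hi⟩ := hH
            obtain ⟨i, rfl⟩ := Fin.exists_succ_eq.2 fun h : i = 0 => h0 (h ▸ hi)
            exact mem_subsetSums.2 ⟨H', ⟨i, by simpa [H'] using hi⟩, rfl⟩
          exact ⟨(h₄ _ hmem).1, hL'.absorbsSums (h₄ _ hmem).2⟩
    intro n
    obtain ⟨L, X, h₁, h₂, h₃, h₄⟩ := key n n
    refine ⟨X :: L, by simp [h₁], ⟨h₂, fun a ha => (h₄ a ha).2⟩, ?_⟩
    simp only [SumsNeZero, List.mem_cons, forall_eq_or_imp]
    exact ⟨fun h => (h₄ 0 h).1 rfl, h₃⟩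

lemma exists_seq_of_coherent {κ : Type} {c : ℚ → κ} (L : List (Fin 1 → ℚ))
    (hL : Coherent c L) (hne : SumsNeZero L) : ∃ a : ℕ → ℚ, (∀ i, a i ≠ 0) ∧
      (∀ F ⊆ Finset.range L.length, ∏ i ∈ F, a i ∈ words L) ∧
      (∀ x, AbsorbsSums c L x → ∀ k < L.length, ∀ F ⊆ Finset.range k, ∀ G ⊆ Finset.range k,
        c ((∏ i ∈ F, a i) * x + (∏ i ∈ G, a i) * a k) = c ((∏ i ∈ F, a i) * x)) ∧
      ∀ l < L.length, ∀ k < l, ∀ F ⊆ Finset.range k, ∀ G ⊆ Finset.range k,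
        c ((∏ i ∈ F, a i) * a l + (∏ i ∈ G, a i) * a k) = c ((∏ i ∈ F, a i) * a l) := by
  induction L with
  | nil =>
    refine ⟨fun _ => 1, by simp, fun F hF => ?_, by simp, by simp⟩
    rw [List.length_nil, Finset.range_zero, Finset.subset_empty] at hF
    simp [hF, words]
  | cons A L ih =>
    simp only [SumsNeZero, List.mem_cons, forall_eq_or_imp] at hne
    obtain ⟨a, ha, hw, hx, hseq⟩ := ih hL.1 hne.2
    have hA : A 0 ∈ subsetSums A := mem_subsetSums.2 ⟨{0}, by simp, by simp⟩
    have hA0 : A 0 ≠ 0 := fun h => hne.1 (h ▸ hA)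
    let a' := Function.update a L.length (A 0)
    have htop : a' L.length = A 0 := Function.update_self ..
    have hlt : ∀ i < L.length, a' i = a i := fun i hi => Function.update_of_ne hi.ne _ _
    have hprod : ∀ k ≤ L.length, ∀ F ⊆ Finset.range k, ∏ i ∈ F, a' i = ∏ i ∈ F, a i :=
      fun k hk F hF => Finset.prod_congr rfl fun i hi =>
        hlt i ((Finset.mem_range.1 (hF hi)).trans_le hk)
    refine ⟨a', fun i => ?_, fun F hF => ?_, fun x habs k hk F hF G hG => ?_,
      fun l hl k hk F hF G hG => ?_⟩
    · by_cases hi : i = L.length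
      · rwa [hi, htop]
      · exact (Function.update_of_ne hi _ _).trans_ne (ha i)
    · rw [List.length_cons, Finset.range_add_one] at hF
      have hF' : F.erase L.length ⊆ Finset.range L.length := by
        rwa [← Finset.subset_insert_iff]
      by_cases hmem : L.length ∈ F
      · rw [← Finset.prod_erase_mul F a' hmem, hprod _ le_rfl _ hF', htop]
        exact Finset.mem_union_right _ (Finset.mul_mem_mul (hw _ hF') hA)
      · rw [Finset.erase_eq_of_notMem hmem] at hF'
        rw [hprod _ le_rfl _ hF']
        exact Finset.mem_union_left _ (hw _ hF')
    · have hk' : k ≤ L.length := Nat.lt_succ_iff.1 hk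
      rw [hprod k hk' F hF, hprod k hk' G hG]
      rcases hk'.lt_or_eq with hk | rfl
      · rw [hlt k hk]
        exact hx x habs.1 k hk F hF G hG
      · rw [htop]
        exact habs.2 _ hA _ (hw F hF) _ (hw G hG)
    · have hl' : l ≤ L.length := Nat.lt_succ_iff.1 hl
      have hkL := hk.trans_le hl'
      rw [hprod k hkL.le F hF, hprod k hkL.le G hG, hlt k hkL]
      rcases hl'.lt_or_eq with hl | rfl
      · rw [hlt l hl]
        exact hseq l hl k hk F hF G hG
      · rw [htop]
        exact hx _ (hL.2 _ hA) k hkL F hF G hG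

lemma Ultrafilter.exists_eventually_eq {α κ : Type*} [Finite κ] (𝒰 : Ultrafilter α) (f : α → κ) :
    ∃ a, ∀ᶠ i in 𝒰, f i = a :=
  Ultrafilter.eventually_exists_iff.1 (Eventually.of_forall fun i => ⟨f i, rfl⟩)

/-- Schur's theorem for colourings of the positive integers. -/
lemma exists_schur {κ : Type} [Finite κ] (d : ℕ → κ) :
    ∃ n m : ℕ, d (m + 1) = d (n + 1) ∧ d (n + 1 + (m + 1)) = d (n + 1) := by
  obtain ⟨s, ⟨a, rfl⟩, b, hb⟩ := Hindman.exists_FS_of_finite_cover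
    (Set.range fun a : κ => {n : ℕ+ | d n = a}) (Set.finite_range _)
    fun n _ => ⟨_, ⟨d n, rfl⟩, rfl⟩
  have h₀ : d (b.get 0) = a := hb (Hindman.FS.singleton b 0)
  have h₁ : d (b.get 1) = a := hb (Hindman.FS.singleton b 1)
  have h₂ : d ((b.get 0 + b.get 1 : ℕ+) : ℕ) = a := hb (Hindman.FS.add_two b 0 1 one_pos)
  rw [PNat.add_coe] at h₂
  refine ⟨b.get 0 - 1, b.get 1 - 1, ?_⟩
  rw [Nat.sub_one_add_one (b.get 0).ne_zero, Nat.sub_one_add_one (b.get 1).ne_zero, h₀, h₁, h₂]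
  exact ⟨rfl, rfl⟩

/-- Ramsey's theorem for finite sets, with the colours of the homogeneous sets not depending on
their size. -/
lemma exists_homogeneous_finset {κ : Type} [Finite κ] (χ : Finset ℕ → κ) :
    ∃ d : ℕ → κ, ∀ j : ℕ, ∃ S : Finset ℕ, S.card = j ∧ ∀ F ⊆ S, χ F = d F.card := by
  choose lim hlim using fun f : ℕ → κ => (hyperfilter ℕ).exists_eventually_eq f
  let D : ℕ → Finset ℕ → κ :=
    Nat.rec χ fun _ E F => lim fun i => E (insert i F)
  have hD : ∀ q F, ∀ᶠ i in hyperfilter ℕ, D q (insert i F) = D (q + 1) F :=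
    fun q F => hlim fun i => D q (insert i F)
  refine ⟨fun q => D q ∅, fun j => ?_⟩
  suffices h : ∀ p : ℕ, ∃ S : Finset ℕ, S.card = j ∧
      ∀ q ≤ p, ∀ F ⊆ S, D q F = D (q + F.card) ∅ by
    obtain ⟨S, hS, hχ⟩ := h 0
    exact ⟨S, hS, fun F hF => (hχ 0 le_rfl F hF).trans (by rw [zero_add])⟩
  induction j with
  | zero =>
    refine fun p => ⟨∅, rfl, fun q _ F hF => ?_⟩
    rw [Finset.subset_empty.1 hF, Finset.card_empty, add_zero]
  | succ j ih =>
    intro p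
    obtain ⟨S, hS, hχ⟩ := ih (p + 1)
    have h₁ : ∀ᶠ i in hyperfilter ℕ, i ∉ S :=
      hyperfilter_le_cofinite S.finite_toSet.compl_mem_cofinite
    have h₂ : ∀ᶠ i in hyperfilter ℕ, ∀ q ∈ Finset.range (p + 1), ∀ F ∈ S.powerset,
        D q (insert i F) = D (q + 1) F :=
      (Finset.eventually_all _).2 fun q _ => (Finset.eventually_all _).2 fun F _ => hD q F
    obtain ⟨i, hi, hDi⟩ := (h₁.and h₂).exists
    refine ⟨insert i S, by rw [Finset.card_insert_of_notMem hi, hS], fun q hq F hF => ?_⟩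
    have hF' : F.erase i ⊆ S := by rwa [← Finset.subset_insert_iff]
    by_cases hiF : i ∈ F
    · have := hDi q (Finset.mem_range.2 (by omega)) _ (Finset.mem_powerset.2 hF')
      rw [Finset.insert_erase hiF] at this
      rw [this, hχ (q + 1) (by omega) _ hF', ← Finset.card_erase_add_one hiF, add_assoc,
        add_comm 1]
    · rw [Finset.erase_eq_of_notMem hiF] at hF'
      exact hχ q (by omega) F hF'

lemma exists_schur_finset {κ : Type} [Finite κ] (χ : Finset ℕ → κ) :
    ∃ k l : ℕ, k < l ∧ ∃ F ⊆ Finset.range k, ∃ G ⊆ Finset.range k, Disjoint F G ∧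
      χ (insert k G) = χ (insert l F) ∧ χ (insert l (insert k (F ∪ G))) = χ (insert l F) := by
  obtain ⟨d, hd⟩ := exists_homogeneous_finset χ
  obtain ⟨n, m, h₁, h₂⟩ := exists_schur d
  obtain ⟨S, hS, hχ⟩ := hd (n + m + 1 + 1)
  have hmax : ∀ (j : ℕ) (T : Finset ℕ), T.card = j + 1 →
      ∃ l ∈ T, (T.erase l).card = j ∧ T.erase l ⊆ Finset.range l := by
    intro j T hT
    have hne : T.Nonempty := Finset.card_pos.1 (by omega)
    refine ⟨T.max' hne, T.max'_mem hne, ?_, fun i hi => ?_⟩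
    · rw [Finset.card_erase_of_mem (T.max'_mem hne), hT, Nat.add_sub_cancel]
    · exact Finset.mem_range.2 (T.lt_max'_of_mem_erase_max' hne hi)
  obtain ⟨l, hl, hcl, hSl⟩ := hmax _ S hS
  obtain ⟨k, hk, hck, hSk⟩ := hmax _ _ hcl
  set T := (S.erase l).erase k with hT
  obtain ⟨F, hFT, hF⟩ := Finset.exists_subset_card_eq (s := T) (n := n) (by omega)
  have hkl : k < l := Finset.mem_range.1 (hSl hk)
  have hlt : ∀ i ∈ T, i < k := fun i hi => Finset.mem_range.1 (hSk hi)
  have hTS : T ⊆ S := (Finset.erase_subset _ _).trans (Finset.erase_subset _ _)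
  have hkS : k ∈ S := Finset.mem_of_mem_erase hk
  have hkT : k ∉ T := fun h => (hlt k h).false
  have hlT : l ∉ insert k T := by
    rw [Finset.mem_insert, not_or]
    exact ⟨hkl.ne', fun h => (hlt l h).not_gt hkl⟩
  have hlF : l ∉ F := fun h => hlT (Finset.mem_insert_of_mem (hFT h))
  refine ⟨k, l, hkl, F, hFT.trans hSk, T \ F, Finset.sdiff_subset.trans hSk,
    Finset.disjoint_sdiff, ?_⟩
  rw [Finset.union_sdiff_of_subset hFT,
    hχ _ (Finset.insert_subset hkS (Finset.sdiff_subset.trans hTS)),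
    hχ _ (Finset.insert_subset hl (hFT.trans hTS)),
    hχ _ (Finset.insert_subset hl (Finset.insert_subset hkS hTS)),
    Finset.card_insert_of_notMem hlT, Finset.card_insert_of_notMem hkT,
    Finset.card_insert_of_notMem hlF,
    Finset.card_insert_of_notMem fun h => hkT (Finset.sdiff_subset h),
    Finset.card_sdiff_of_subset hFT, hck, hF, Nat.add_sub_cancel_left, h₁]
  refine ⟨rfl, ?_⟩
  rw [← h₂]
  congr 1
  omega

lemma exists_mono_quadruple {κ : Type} [Finite κ] (c : ℚ → κ) : ∃ x y : ℚ, x ≠ 0 ∧ y ≠ 0 ∧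
    c y = c x ∧ c (x * y) = c x ∧ c (x + y) = c x := by
  have hseq : ∀ M : ℕ, ∃ a : ℕ → ℚ, (∀ i, a i ≠ 0) ∧
      ∀ l < M, ∀ k < l, ∀ F ⊆ Finset.range k, ∀ G ⊆ Finset.range k,
        c ((∏ i ∈ F, a i) * a l + (∏ i ∈ G, a i) * a k) = c ((∏ i ∈ F, a i) * a l) := by
    intro M
    obtain ⟨L, rfl, hL, hne⟩ := exists_coherent c M 1
    obtain ⟨a, ha, -, -, h⟩ := exists_seq_of_coherent L hL hne
    exact ⟨a, ha, h⟩
  choose a ha hseq using hseq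
  choose χ hχ using fun F : Finset ℕ =>
    (hyperfilter ℕ).exists_eventually_eq fun M => c (∏ i ∈ F, a M i)
  obtain ⟨k, l, hkl, F, hF, G, hG, hFG, h₁, h₂⟩ := exists_schur_finset χ
  have hl : ∀ᶠ M in hyperfilter ℕ, l < M := Nat.hyperfilter_le_atTop (eventually_gt_atTop l)
  obtain ⟨M, hlM, hx, hy, hxy⟩ := (hl.and ((hχ (insert l F)).and ((hχ (insert k G)).and
    (hχ (insert l (insert k (F ∪ G))))))).exists
  have hkF : k ∉ F := fun h => (Finset.mem_range.1 (hF h)).false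
  have hkG : k ∉ G := fun h => (Finset.mem_range.1 (hG h)).false
  have hlF : l ∉ F := fun h => (Finset.mem_range.1 (hF h)).not_gt hkl
  have hlG : l ∉ G := fun h => (Finset.mem_range.1 (hG h)).not_gt hkl
  rw [Finset.prod_insert hlF, mul_comm] at hx
  rw [Finset.prod_insert hkG, mul_comm] at hy
  rw [Finset.prod_insert (by simp [hkl.ne', hlF, hlG]), Finset.prod_insert (by simp [hkF, hkG]),
    Finset.prod_union hFG] at hxy
  refine ⟨(∏ i ∈ F, a M i) * a M l, (∏ i ∈ G, a M i) * a M k,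
    mul_ne_zero (Finset.prod_ne_zero_iff.2 fun i _ => ha M i) (ha M l),
    mul_ne_zero (Finset.prod_ne_zero_iff.2 fun i _ => ha M i) (ha M k), ?_, ?_,
    hseq M l hlM k hkl F hF G hG⟩
  · rw [hx, hy, h₁]
  · rw [hx, ← h₂, ← hxy]
    congr 1
    ring

lemma padicValRat_add_self {x : ℚ} (hx : x ≠ 0) :
    padicValRat 2 (x + x) = padicValRat 2 x + 1 := by
  have : Fact (Nat.Prime 2) := ⟨Nat.prime_two⟩
  have h2 : padicValRat 2 (2 : ℚ) = 1 := by
    simpa using padicValRat.self (p := 2) one_lt_two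
  rw [← two_mul, padicValRat.mul two_ne_zero hx, h2, add_comm]

/-- For any coloring of the rationals into finitely many colors, there exist nonzero
rationals `x` and `y` such that `x`, `y`, `x*y`, `x+y` are pairwise distinct and
`{x, y, x*y, x+y}` is monochromatic. -/
theorem hindman_quadruple_distinct (n : ℕ) (c : ℚ → Fin n) :
    ∃ x y : ℚ, x ≠ 0 ∧ y ≠ 0 ∧
      x ≠ y ∧ x ≠ x * y ∧ x ≠ x + y ∧ y ≠ x * y ∧ y ≠ x + y ∧ x * y ≠ x + y ∧
      c y = c x ∧ c (x * y) = c x ∧ c (x + y) = c x := by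
  obtain ⟨x, y, hx, hy, h₁, h₂, h₃⟩ := exists_mono_quadruple fun q : ℚ =>
    (c q, decide (q = 1), decide (Even (padicValRat 2 q)), decide (3 < q), decide (0 < q))
  simp only [Prod.mk.injEq, decide_eq_decide] at h₁ h₂ h₃
  obtain ⟨hc₁, hone₁, -, hthree₁, hpos₁⟩ := h₁
  obtain ⟨hc₂, -, -, hthree₂, -⟩ := h₂
  obtain ⟨hc₃, hone₃, heven, hthree₃, -⟩ := h₃
  have hx1 : x ≠ 1 := by
    intro h
    have h' := hone₁.2 h
    have := hone₃.2 h
    rw [h, h'] at this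
    norm_num at this
  have hy1 : y ≠ 1 := fun h => hx1 (hone₁.1 h)
  refine ⟨x, y, hx, hy, ?_, ?_, ?_, ?_, ?_, ?_, hc₁, hc₂, hc₃⟩
  · rintro rfl
    rw [padicValRat_add_self hx, Int.even_add_one] at heven
    tauto
  · simpa [hx, eq_comm] using hy1
  · simpa [eq_comm] using hy
  · simpa [hy, eq_comm] using hx1
  · simpa [eq_comm] using hx
  · intro h
    have hprod : (x - 1) * (y - 1) = 1 := by linarith
    by_cases hx0 : 0 < x
    · have hy0 : 0 < y := hpos₁.2 hx0
      have hge : ¬ 3 < x := by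
        intro hx3
        have hy3 := hthree₁.2 hx3
        nlinarith
      have hge' : ¬ 3 < x + y := fun h => hge (hthree₃.1 h)
      nlinarith [sq_nonneg (x - y)]
    · have hy0 : ¬ 0 < y := fun h => hx0 (hpos₁.1 h)
      have hx' : x < 0 := lt_of_le_of_ne (not_lt.1 hx0) hx
      have hy' : y < 0 := lt_of_le_of_ne (not_lt.1 hy0) hy
      nlinarith
end

section
/- Let K be a field of characteristic zero. For any coloring of K into finitely many colors, there exist nonzero elements x and y of K such that the set {x, y, x*y, x + y} is monochromatic. -/
/-- A form of the van der Waerden theorem in which the dilation factor is bounded, and the base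
point is confined to finitely many translates, independently of the coloring. -/
theorem exists_bounded_mono_homothetic (K : Type*) [Field K] (τ κ : Type) [Finite τ] [Finite κ] :
    ∃ (Q : ℕ) (β : Type), Finite β ∧ ∀ δ : τ → K, ∃ w : β → K, ∀ (ψ : K → κ) (y : K),
      ∃ (b : β) (d : ℕ), 1 ≤ d ∧ d ≤ Q ∧ ∀ t, ψ (y + w b + d * δ t) = ψ (y + w b) := by
  classical
  obtain ⟨ι, _, hι⟩ := Combinatorics.Line.exists_mono_in_high_dimension (Option τ) κ
  refine ⟨Fintype.card ι, ι → Option τ, inferInstance, fun δ => ?_⟩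
  let e : Option τ → K := fun o => o.elim 0 δ
  refine ⟨fun b => ∑ i, e (b i), fun ψ y => ?_⟩
  obtain ⟨l, col, hl⟩ := hι fun b => ψ (y + ∑ i, e (b i))
  obtain ⟨i₀, hi₀⟩ := l.proper
  refine ⟨l none, (Finset.univ.filter fun i => l.idxFun i = none).card,
    Finset.card_pos.2 ⟨i₀, by simp [hi₀]⟩, Finset.card_le_univ _, fun t => ?_⟩
  have key : ∑ i, e (l (some t) i) = ∑ i, e (l none i) +
      (Finset.univ.filter fun i => l.idxFun i = none).card * δ t := by
    rw [← nsmul_eq_mul, ← Finset.sum_const, Finset.sum_filter, ← Finset.sum_add_distrib]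
    refine Finset.sum_congr rfl fun i _ => ?_
    cases h : l.idxFun i <;> simp [h, e]
  rw [add_assoc, ← key]
  exact (hl (some t)).trans (hl none).symm

/-- Given nonzero `c i`, some translate `x` of `y` and bounded multiples `u i = d i * c i` satisfy:
for `i < j < s`, adding a small rational multiple of `u j / u i` to a small rational multiple of
`u i * x` does not change the color. -/
theorem exists_chain {K : Type*} [Field K] [CharZero K] {n : ℕ} (χ : K → Fin n) (q s : ℕ) :
    ∃ (Q : ℕ) (β : Type), Finite β ∧ ∀ c : ℕ → K, (∀ i, c i ≠ 0) → ∃ v : β → K, ∀ y : K,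
      ∃ (b₀ : β) (d : ℕ → ℕ), (∀ i, 1 ≤ d i ∧ d i ≤ Q) ∧ ∀ i j, i < j → j < s →
        ∀ a b m : ℕ, 1 ≤ a → a ≤ q → 1 ≤ b → b ≤ q → 1 ≤ m → m ≤ q →
          χ (a * (d i * c i) / m * (y + v b₀) + b * (d j * c j) / (a * (d i * c i))) =
            χ (a * (d i * c i) / m * (y + v b₀)) := by
  induction s with
  | zero =>
    exact ⟨1, Unit, inferInstance, fun c _ => ⟨fun _ => 0, fun y => ⟨(), fun _ => 1, by simp,
      by simp⟩⟩⟩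
  | succ s ih =>
    obtain ⟨Q, β, _, hβ⟩ := ih
    obtain ⟨Q₁, β₁, _, hβ₁⟩ := exists_bounded_mono_homothetic K
      (Fin s × Fin (q + 1) × Fin (q + 1) × Fin (q + 1) × Fin (Q + 1))
      (β × (Fin s → Fin (Q + 1)) × (Fin s → Fin (q + 1) → Fin (q + 1) → Fin n))
    refine ⟨max Q Q₁, β × β₁, inferInstance, fun c hc => ?_⟩
    obtain ⟨v, hv⟩ := hβ c hc
    choose B D hD hgood using hv
    obtain ⟨w, hw⟩ := hβ₁ fun t => (t.2.2.2.1 : ℕ) * (t.2.2.1 : ℕ) * c s /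
      ((t.2.1 : ℕ) * ((t.2.2.2.2 : ℕ) * c t.1)) ^ 2
    refine ⟨fun p => v p.1 + w p.2, fun y => ?_⟩
    obtain ⟨b₁, d₁, hd₁, hd₁Q, hψ⟩ := hw (fun y => (B y,
      fun i => ⟨D y i, Nat.lt_succ_of_le (hD y i).2⟩,
      fun i a m => χ ((a : ℕ) * (D y i * c i) / (m : ℕ) * (y + v (B y))))) y
    have hx : y + (v (B (y + w b₁)) + w b₁) = y + w b₁ + v (B (y + w b₁)) := by ring
    refine ⟨(B (y + w b₁), b₁), Function.update (D (y + w b₁)) s d₁, fun i => ?_, ?_⟩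
    · rcases eq_or_ne i s with rfl | h
      · simp [hd₁, hd₁Q]
      · simp [h, hD]
    · intro i j hij hj a b m ha haq hb hbq hm hmq
      have his : i < s := by omega
      simp only [hx, Function.update_of_ne his.ne]
      rcases eq_or_ne j s with rfl | h
      · have := hψ (⟨i, his⟩, ⟨a, by omega⟩, ⟨b, by omega⟩, ⟨m, by omega⟩,
          ⟨D (y + w b₁) i, Nat.lt_succ_of_le (hD _ i).2⟩)
        simp only [Prod.mk.injEq] at this
        obtain ⟨hB, hDeq, hχ⟩ := this
        have h1 := congr_fun hDeq ⟨i, his⟩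
        have h2 := congr_fun (congr_fun (congr_fun hχ ⟨i, his⟩) ⟨a, by omega⟩) ⟨m, by omega⟩
        simp only [Fin.mk.injEq] at h1
        simp only [hB, h1] at h2
        rw [← h2, Function.update_self]
        congr 1
        have hD0 : (D (y + w b₁) i : K) ≠ 0 := by
          have := (hD (y + w b₁) i).1
          exact_mod_cast (by omega)
        have ha0 : (a : K) ≠ 0 := by exact_mod_cast (by omega)
        have hm0 : (m : K) ≠ 0 := by exact_mod_cast (by omega)
        have := hc i
        field_simp
        ring
      · simp only [Function.update_of_ne h]
        exact hgood _ i j hij (by omega) a b m ha haq hb hbq hm hmq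

/-- There is a sequence of nonzero elements for which, whenever `l < i < j < k`, adding small
rational multiples of `c j / c i` to those of `c i / c l` does not change the color. -/
theorem exists_triangle_sequence {K : Type*} [Field K] [CharZero K] {n : ℕ} (χ : K → Fin n)
    (k N : ℕ) : ∃ c : ℕ → K, (∀ i, c i ≠ 0) ∧ ∀ l i j, l < i → i < j → j < k →
      ∀ a b m : ℕ, 1 ≤ a → a ≤ N → 1 ≤ b → b ≤ N → 1 ≤ m → m ≤ N →
        χ (a * c i / (m * c l) + b * c j / (a * c i)) = χ (a * c i / (m * c l)) := by
  induction k generalizing N with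
  | zero => exact ⟨fun _ => 1, by simp, by simp⟩
  | succ k ih =>
    obtain ⟨Q, β, _, hβ⟩ := exists_chain χ N k
    obtain ⟨c, hc, hT⟩ := ih (N * Q)
    obtain ⟨v, hv⟩ := hβ c hc
    obtain ⟨y, hy⟩ := (Set.finite_range fun b => -v b).exists_notMem
    obtain ⟨b₀, d, hd, hgood⟩ := hv y
    have hx : y + v b₀ ≠ 0 := fun h => hy ⟨b₀, (eq_neg_of_add_eq_zero_left h).symm⟩
    have hd0 : ∀ i, (d i : K) ≠ 0 := fun i => by
      have := (hd i).1
      exact_mod_cast (by omega)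
    refine ⟨fun i => Nat.casesOn i (y + v b₀)⁻¹ fun i => d i * c i, fun i => ?_, ?_⟩
    · cases i with
      | zero => exact inv_ne_zero hx
      | succ i => exact mul_ne_zero (hd0 i) (hc i)
    · intro l i j hli hij hj a b m ha haN hb hbN hm hmN
      obtain ⟨i, rfl⟩ := Nat.exists_eq_succ_of_ne_zero (by omega : i ≠ 0)
      obtain ⟨j, rfl⟩ := Nat.exists_eq_succ_of_ne_zero (by omega : j ≠ 0)
      cases l with
      | zero =>
        have := hgood i j (by omega) (by omega) a b m ha haN hb hbN hm hmN
        simpa [div_eq_mul_inv, mul_inv_rev, mul_assoc, mul_comm, mul_left_comm] using this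
      | succ l =>
        have h1 : ∀ {a i}, 1 ≤ a → 1 ≤ a * d i := fun h => Nat.mul_pos h (hd _).1
        have h2 : ∀ {a i}, a ≤ N → a * d i ≤ N * Q := fun h => Nat.mul_le_mul h (hd _).2
        have := hT l i j (by omega) (by omega) (by omega) (a * d i) (b * d j) (m * d l)
          (h1 ha) (h2 haN) (h1 hb) (h2 hbN) (h1 hm) (h2 hmN)
        simpa [mul_assoc] using this

/-- The Ramsey theorem for triangles, with colors taken from a finite set `S`. -/
theorem exists_mono_triangle_of_colors {C : Type*} (S : Finset C) :
    ∃ m : ℕ, ∀ (f : ℕ → ℕ → C) (A : Finset ℕ), m ≤ A.card →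
      (∀ i ∈ A, ∀ j ∈ A, i < j → f i j ∈ S) →
      ∃ l ∈ A, ∃ i ∈ A, ∃ j ∈ A, l < i ∧ i < j ∧ f l i = f l j ∧ f i j = f l j := by
  classical
  induction hs : S.card generalizing S with
  | zero =>
    refine ⟨2, fun f A hA h => ?_⟩
    obtain ⟨i, hi, j, hj, hij⟩ := Finset.one_lt_card.1 (by omega : 1 < A.card)
    rw [Finset.card_eq_zero] at hs
    subst hs
    rcases lt_or_gt_of_ne hij with h' | h'
    · simpa using h i hi j hj h'
    · simpa using h j hj i hi h'
  | succ s ih =>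
    have : ∀ x : C, ∃ m : ℕ, x ∈ S → ∀ (f : ℕ → ℕ → C) (A : Finset ℕ), m ≤ A.card →
        (∀ i ∈ A, ∀ j ∈ A, i < j → f i j ∈ S.erase x) →
        ∃ l ∈ A, ∃ i ∈ A, ∃ j ∈ A, l < i ∧ i < j ∧ f l i = f l j ∧ f i j = f l j := by
      intro x
      by_cases hx : x ∈ S
      · obtain ⟨m, hm⟩ := ih (S.erase x) (by rw [Finset.card_erase_of_mem hx]; omega)
        exact ⟨m, fun _ => hm⟩
      · exact ⟨0, fun h => absurd h hx⟩
    choose m hm using this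
    refine ⟨(∑ x ∈ S, m x) + 2, fun f A hA h => ?_⟩
    have hne : A.Nonempty := Finset.card_pos.1 (by omega)
    set l := A.min' hne with hl
    have hlA : l ∈ A := A.min'_mem hne
    have hlt : ∀ i ∈ A.erase l, l < i := fun i hi => A.min'_lt_of_mem_erase_min' hne hi
    obtain ⟨x, hxS, hx⟩ : ∃ x ∈ S, m x ≤ ((A.erase l).filter fun i => f l i = x).card := by
      by_contra! hcon
      have h1 : (A.erase l).card = ∑ x ∈ S, ((A.erase l).filter fun i => f l i = x).card :=
        Finset.card_eq_sum_card_fiberwise fun i hi =>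
          h l hlA i (Finset.mem_of_mem_erase hi) (hlt i hi)
      have h2 := Finset.sum_le_sum fun x hx => (hcon x hx).le
      rw [← h1, Finset.card_erase_of_mem hlA] at h2
      omega
    by_cases hex : ∃ i ∈ (A.erase l).filter (fun i => f l i = x),
        ∃ j ∈ (A.erase l).filter (fun i => f l i = x), i < j ∧ f i j = x
    · obtain ⟨i, hi, j, hj, hij, hfij⟩ := hex
      rw [Finset.mem_filter] at hi hj
      exact ⟨l, hlA, i, Finset.mem_of_mem_erase hi.1, j, Finset.mem_of_mem_erase hj.1,
        hlt i hi.1, hij, hi.2.trans hj.2.symm, hfij.trans hj.2.symm⟩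
    · push Not at hex
      have hsub : ∀ i ∈ (A.erase l).filter (fun i => f l i = x), i ∈ A := fun i hi =>
        Finset.mem_of_mem_erase (Finset.mem_filter.1 hi).1
      obtain ⟨l', hl', i, hi, j, hj, hres⟩ := hm x hxS f _ hx fun i hi j hj hij =>
        Finset.mem_erase.2 ⟨hex i hi j hj hij, h i (hsub i hi) j (hsub j hj) hij⟩
      exact ⟨l', hsub _ hl', i, hsub _ hi, j, hsub _ hj, hres⟩

/-- Let `K` be a field of characteristic zero. For any coloring of `K` into finitely
many colors, there exist nonzero `x y : K` with `{x, y, x*y, x+y}` monochromatic. -/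
theorem hindman_quadruple_charZero (K : Type*) [Field K] [CharZero K]
    (n : ℕ) (c : K → Fin n) :
    ∃ x y : K, x ≠ 0 ∧ y ≠ 0 ∧ c y = c x ∧ c (x * y) = c x ∧ c (x + y) = c x := by
  obtain ⟨m, hm⟩ := exists_mono_triangle_of_colors (Finset.univ : Finset (Fin n))
  obtain ⟨u, hu, hT⟩ := exists_triangle_sequence c m 1
  obtain ⟨l, -, i, -, j, hj, hli, hij, h1, h2⟩ := hm (fun i j => c (u j / u i)) (Finset.range m)
    (by simp) (by simp)
  refine ⟨u i / u l, u j / u i, div_ne_zero (hu i) (hu l), div_ne_zero (hu j) (hu i),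
    h2.trans h1.symm, ?_, ?_⟩
  · rw [mul_comm, div_mul_div_cancel₀ (hu i)]
    exact h1.symm
  · simpa using hT l i j hli hij (Finset.mem_range.1 hj) 1 1 1 le_rfl le_rfl le_rfl le_rfl
      le_rfl le_rfl
end

section
/- Let k, r, N be natural numbers and let T₁, …, T_k ⊆ ℚ \ {0} be multiplicatively thick sets. Then there exist sets S_{l,j} ⊆ T_l for each l ∈ {1,…,k} and each j ∈ {0,…,N-1}, each of which is an IP_r set, such that for any 0 ≤ i ≤ j ≤ N-1 and any indices l_i, l_{i+1}, …, l_j ∈ {1,…,k}, the product set S_{l_i,i} · S_{l_{i+1},i+1} · ⋯ · S_{l_j,j} (the set of all products s_i * s_{i+1} * ⋯ * s_j with s_m ∈ S_{l_m,m} for i ≤ m ≤ j) is contained in T_{l_i}. -/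
/-- A set `S ⊆ ℚ` is an IP_r set if it contains all sums of nonempty subsequences of
some sequence of `r` rationals. -/
def IsIPr (r : ℕ) (S : Set ℚ) : Prop :=
  ∃ a : Fin r → ℚ, ∀ I : Finset (Fin r), I.Nonempty → (∑ i ∈ I, a i) ∈ S

/-- A set `T ⊆ ℚ \ {0}` is multiplicatively thick if for every finite set `F` of
nonzero rationals there is `a : ℚ` with `a • F ⊆ T`. -/
def MulThick (T : Set ℚ) : Prop :=
  ∀ F : Finset ℚ, (∀ f ∈ F, f ≠ 0) → ∃ a : ℚ, ∀ f ∈ F, a * f ∈ T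

open scoped Pointwise

/-- For a multiplicatively thick set `T` and a finite set `Q` of nonzero rationals, some dilate of
`{1, …, r}` multiplies `Q` into `T`. -/
lemma MulThick.exists_dilate_Icc_mul_mem {T : Set ℚ} (hT : MulThick T) (r : ℕ) (Q : Finset ℚ)
    (hQ : ∀ q ∈ Q, q ≠ 0) : ∃ a : ℚ, ∀ n ∈ Finset.Icc 1 r, ∀ q ∈ Q, a * n * q ∈ T := by
  obtain ⟨a, ha⟩ := hT ((Finset.Icc 1 r).image (fun n : ℕ => (n : ℚ)) * Q) (by
    intro f hf
    obtain ⟨x, hx, q, hq, rfl⟩ := Finset.mem_mul.1 hf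
    obtain ⟨n, hn, rfl⟩ := Finset.mem_image.1 hx
    have hn1 : n ≠ 0 := by have := (Finset.mem_Icc.1 hn).1; lia
    exact mul_ne_zero (Nat.cast_ne_zero.2 hn1) (hQ q hq))
  refine ⟨a, fun n hn q hq => ?_⟩
  rw [mul_assoc]
  exact ha _ (Finset.mul_mem_mul (Finset.mem_image_of_mem _ hn) hq)

/-- The dilate by `a` of `{1, …, r}` is an IP_r set, witnessed by the constant sequence `a`. -/
lemma isIPr_dilate_Icc (r : ℕ) (a : ℚ) :
    IsIPr r (((Finset.Icc 1 r).image fun n : ℕ => a * n : Finset ℚ) : Set ℚ) := by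
  refine ⟨fun _ => a, fun I hI => ?_⟩
  rw [Finset.mem_coe, Finset.mem_image]
  refine ⟨I.card, Finset.mem_Icc.2 ⟨hI.card_pos, ?_⟩, ?_⟩
  · simpa using Finset.card_le_univ I
  · simp [mul_comm]

/-- If `Q n` contains `1` and `A n * Q n ⊆ Q (n + 1)` for all `n`, then `Q (M - i)` contains every
product of `s m ∈ A (M - m)` over `i < m ≤ i + d ≤ M`. -/
lemma prod_Ioc_mem_of_mul_mem {R : Type*} [CommMonoid R] {A Q : ℕ → Finset R}
    (h1 : ∀ n, 1 ∈ Q n) (hQ : ∀ n, ∀ x ∈ A n, ∀ q ∈ Q n, x * q ∈ Q (n + 1)) (M : ℕ) (s : ℕ → R)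
    (d i : ℕ) (hd : i + d ≤ M) (hs : ∀ m, i < m → m ≤ i + d → s m ∈ A (M - m)) :
    ∏ m ∈ Finset.Ioc i (i + d), s m ∈ Q (M - i) := by
  induction d generalizing i with
  | zero => simpa using h1 _
  | succ d ih =>
    have h := ih (i + 1) (by lia) (fun m h₁ h₂ => hs m (by lia) (by lia))
    have h' := hQ _ _ (hs (i + 1) (by lia) (by lia)) _ h
    rw [show M - (i + 1) + 1 = M - i by lia, show i + 1 + d = i + (d + 1) by lia] at h'
    have hI : Finset.Ioc i (i + (d + 1)) = insert (i + 1) (Finset.Ioc (i + 1) (i + (d + 1))) := by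
      ext m
      simp only [Finset.mem_Ioc, Finset.mem_insert]
      lia
    rwa [hI, Finset.prod_insert (by simp)]

/-- Given multiplicatively thick sets `T 1, …, T k ⊆ ℚ \ {0}` and `r N : ℕ`, there are
IP_r sets `S l j ⊆ T l` (for `l < k`, `j < N`) such that any product
`s i * s (i+1) * ⋯ * s j` with `s m ∈ S (l m) m` lands in `T (l i)`. -/
theorem thick_product_IPr (k r N : ℕ) (T : Fin k → Set ℚ)
    (hT0 : ∀ l, ∀ q ∈ T l, q ≠ 0) (hT : ∀ l, MulThick (T l)) :
    ∃ S : Fin k → Fin N → Set ℚ,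
      (∀ l j, S l j ⊆ T l) ∧
      (∀ l j, IsIPr r (S l j)) ∧
      (∀ i j : Fin N, i ≤ j → ∀ l : Fin N → Fin k, ∀ s : Fin N → ℚ,
        (∀ m : Fin N, i ≤ m → m ≤ j → s m ∈ S (l m) m) →
        (∏ m ∈ Finset.Icc i j, s m) ∈ T (l i)) := by
  classical
  have hex : ∀ (l : Fin k) (Q : Finset ℚ), ∃ a : ℚ, (∀ q ∈ Q, q ≠ 0) →
      ∀ n ∈ Finset.Icc 1 r, ∀ q ∈ Q, a * n * q ∈ T l := fun l Q => by
    by_cases hQ : ∀ q ∈ Q, q ≠ 0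
    · obtain ⟨a, ha⟩ := (hT l).exists_dilate_Icc_mul_mem r Q hQ
      exact ⟨a, fun _ => ha⟩
    · exact ⟨0, fun h => absurd h hQ⟩
  choose a ha using hex
  let B : Fin k → Finset ℚ → Finset ℚ := fun l Q => (Finset.Icc 1 r).image fun n : ℕ => a l Q * n
  let Q : ℕ → Finset ℚ := fun n =>
    Nat.rec {1} (fun _ P => insert 1 (Finset.univ.biUnion (fun l => B l P) * P)) n
  let A : ℕ → Finset ℚ := fun n => Finset.univ.biUnion fun l => B l (Q n)
  have hQs : ∀ n, Q (n + 1) = insert 1 (A n * Q n) := fun n => rfl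
  have h1 : ∀ n, 1 ∈ Q n := by
    rintro (_ | n)
    · exact Finset.mem_singleton_self 1
    · exact Finset.mem_insert_self _ _
  have hB : ∀ P : Finset ℚ, (∀ q ∈ P, q ≠ 0) → ∀ l, ∀ x ∈ B l P, ∀ q ∈ P, x * q ∈ T l := by
    intro P hP l x hx q hq
    obtain ⟨n, hn, rfl⟩ := Finset.mem_image.1 hx
    exact ha l P hP n hn q hq
  have hQ0 : ∀ n, ∀ q ∈ Q n, q ≠ 0 := by
    intro n
    induction n with
    | zero =>
      intro q hq
      rw [Finset.mem_singleton.1 hq]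
      exact one_ne_zero
    | succ n ih =>
      intro q hq
      rw [hQs, Finset.mem_insert] at hq
      obtain rfl | hq := hq
      · exact one_ne_zero
      · obtain ⟨x, hx, p, hp, rfl⟩ := Finset.mem_mul.1 hq
        obtain ⟨l, -, hx⟩ := Finset.mem_biUnion.1 hx
        exact hT0 l _ (hB _ ih l x hx p hp)
  refine ⟨fun l j => B l (Q (N - j)), fun l j x hx => ?_, fun l j => isIPr_dilate_Icc r _, ?_⟩
  · simpa using hB _ (hQ0 _) l x hx 1 (h1 _)
  · intro i j hij l s hs
    let t : ℕ → ℚ := fun m => if h : m < N then s ⟨m, h⟩ else 1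
    have ht : ∀ m : Fin N, t m = s m := fun m => dif_pos m.2
    have htail : ∏ m ∈ Finset.Ioc i j, s m ∈ Q (N - i) := by
      have h := prod_Ioc_mem_of_mul_mem (A := A) h1
        (fun n x hx q hq => Finset.mem_insert_of_mem (Finset.mul_mem_mul hx hq)) N t (j - i) i
        (by lia) (fun m h₁ h₂ => by
          have hm : m < N := by lia
          have hmem := hs ⟨m, hm⟩ (Fin.le_def.2 h₁.le) (Fin.le_def.2 (by simp only; lia))
          rw [← ht] at hmem
          exact Finset.mem_biUnion.2 ⟨l ⟨m, hm⟩, Finset.mem_univ _, hmem⟩)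
      rw [Nat.add_sub_cancel' (Fin.le_def.1 hij), ← Fin.map_valEmbedding_Ioc,
        Finset.prod_map] at h
      simpa [ht] using h
    rw [← Finset.Ioc_insert_left hij, Finset.prod_insert (by simp)]
    exact hB _ (hQ0 _) (l i) _ (hs i le_rfl hij) _ htail
end

section
/- Let ℚ \ {0} = C₁ ∪ ⋯ ∪ C_n be a coloring of the nonzero rationals into n sets. Then there exist k ∈ ℕ, index sets Y₁, …, Y_k ⊆ {1,…,n}, and a finite set F ⊆ ℚ \ {0} such that: (i) for each l ∈ {1,…,k}, the union ⋃_{m ∈ Y_l} C_m is multiplicatively thick; and (ii) for each x ∈ ℚ \ {0} there exists l ∈ {1,…,k} such that for every m ∈ Y_l one has x ∈ F · C_m (i.e., x = f*c for some f ∈ F and c ∈ C_m). -/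
/-- Localizing thick sets in a finite coloring `ℚ \ {0} = C 1 ∪ ⋯ ∪ C n`:
there are `k`, index sets `Y 1, …, Y k ⊆ {1,…,n}` and a finite set `F` of nonzero
rationals such that (i) each union `⋃_{m ∈ Y l} C m` is multiplicatively thick, and
(ii) every nonzero `x` satisfies `x ∈ F · C m` for all `m ∈ Y l`, for some `l`. -/
theorem localize_thick_sets (n : ℕ) (C : Fin n → Set ℚ)
    (hC0 : ∀ i, ∀ q ∈ C i, q ≠ 0)
    (hcover : ∀ x : ℚ, x ≠ 0 → ∃ i, x ∈ C i) :
    ∃ (k : ℕ) (Y : Fin k → Finset (Fin n)) (F : Finset ℚ),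
      (∀ f ∈ F, f ≠ 0) ∧
      (∀ l : Fin k, MulThick (⋃ m ∈ Y l, C m)) ∧
      (∀ x : ℚ, x ≠ 0 → ∃ l : Fin k, ∀ m ∈ Y l,
        ∃ f ∈ F, ∃ s ∈ C m, x = f * s) := by
  classical
  have hG : ∀ Y : Finset (Fin n), ∃ G : Finset ℚ, (∀ g ∈ G, g ≠ 0) ∧
      ((∃ a : ℚ, ∀ g ∈ G, a * g ∈ ⋃ m ∈ Y, C m) → MulThick (⋃ m ∈ Y, C m)) := by
    intro Y
    by_cases h : MulThick (⋃ m ∈ Y, C m)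
    · exact ⟨∅, by simp, fun _ => h⟩
    · have h' := h
      unfold MulThick at h'
      push Not at h'
      obtain ⟨G, hG0, hG⟩ := h'
      refine ⟨G, hG0, fun ⟨a, ha⟩ => ?_⟩
      obtain ⟨g, hg, hag⟩ := hG a
      exact absurd (ha g hg) hag
  choose G hG0 hGthick using hG
  let e := Fintype.equivFin {Y : Finset (Fin n) // MulThick (⋃ m ∈ Y, C m)}
  refine ⟨_, fun l => (e.symm l).1, (Finset.univ.biUnion G).image (·⁻¹), ?_,
    fun l => (e.symm l).2, fun x hx => ?_⟩
  · simp only [Finset.mem_image, Finset.mem_biUnion, Finset.mem_univ, true_and]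
    rintro _ ⟨g, ⟨Y, hg⟩, rfl⟩
    exact inv_ne_zero (hG0 Y g hg)
  · let Z : Finset (Fin n) :=
      Finset.univ.filter fun m => ∃ g ∈ Finset.univ.biUnion G, x * g ∈ C m
    have hZ : MulThick (⋃ m ∈ Z, C m) := by
      refine hGthick Z ⟨x, fun g hg => ?_⟩
      obtain ⟨m, hm⟩ := hcover (x * g) (mul_ne_zero hx (hG0 Z g hg))
      exact Set.mem_biUnion (Finset.mem_filter.2 ⟨Finset.mem_univ m, g,
        Finset.mem_biUnion.2 ⟨Z, Finset.mem_univ Z, hg⟩, hm⟩) hm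
    refine ⟨e ⟨Z, hZ⟩, fun m hm => ?_⟩
    simp only [Equiv.symm_apply_apply] at hm
    obtain ⟨g, hg, hgm⟩ := (Finset.mem_filter.1 hm).2
    obtain ⟨Y, -, hgY⟩ := Finset.mem_biUnion.1 hg
    have hg0 := hG0 Y g hgY
    exact ⟨g⁻¹, Finset.mem_image_of_mem _ hg, x * g, hgm, by field_simp⟩
end

section
/- Suppose ℚ = C₁ ∪ ⋯ ∪ C_n is a coloring of the rationals into n sets such that each C_i ∩ (ℚ \ {0}) is multiplicatively syndetic. Then there exist nonzero rationals x and y and an index i such that {x, y, x*y, x + y} ⊆ C_i. -/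
/-- A set `S ⊆ ℚ \ {0}` is multiplicatively syndetic if there is a finite set `F` of
nonzero rationals such that every nonzero rational is `f * s` with `f ∈ F`, `s ∈ S`. -/
def MulSyndetic (S : Set ℚ) : Prop :=
  ∃ F : Finset ℚ, (∀ f ∈ F, f ≠ 0) ∧ ∀ x : ℚ, x ≠ 0 → ∃ f ∈ F, ∃ s ∈ S, x = f * s

/-- A uniform van der Waerden theorem: the dilation factor and the base point of a monochromatic
homothetic copy of `S` can be taken from a finite set that does not depend on the coloring. -/
theorem exists_finset_mono_homothetic_copy {κ : Type*} [Finite κ] (S : Finset ℚ) :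
    ∃ N : Finset (ℚ × ℚ), (∀ p ∈ N, p.1 ≠ 0) ∧
      ∀ c : ℚ → κ, ∃ p ∈ N, ∃ k, ∀ s ∈ S, c (p.2 + p.1 * s) = k := by
  classical
  obtain ⟨ι, _, hι⟩ := Combinatorics.Line.exists_mono_in_high_dimension S κ
  let pt : (ι → Option S) → ℚ × ℚ := fun o =>
    (∑ i, if o i = none then 1 else 0, ∑ i, ((o i).map Subtype.val).getD 0)
  refine ⟨(Finset.univ.image pt).filter fun p => p.1 ≠ 0, fun p hp => (Finset.mem_filter.1 hp).2,
    fun c => ?_⟩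
  obtain ⟨l, k, hl⟩ := hι fun v => c (∑ i, (v i : ℚ))
  refine ⟨pt l.idxFun, ?_, k, fun s hs => ?_⟩
  · refine Finset.mem_filter.2 ⟨Finset.mem_image_of_mem _ (Finset.mem_univ _), ne_of_gt ?_⟩
    obtain ⟨i, hi⟩ := l.proper
    refine Finset.sum_pos' (fun j _ => ?_) ⟨i, Finset.mem_univ _, ?_⟩
    · split_ifs <;> norm_num
    · simp [hi]
  · rw [← hl ⟨s, hs⟩]
    congr 1
    simp only [pt, Finset.sum_mul, ← Finset.sum_add_distrib]
    refine Finset.sum_congr rfl fun i _ => ?_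
    cases h : l.idxFun i <;> simp [Combinatorics.Line.coe_apply, h]

/-- For finite colorings `ψ q` of `ℚ` indexed by `q : ℚ`, there are nonzero `Y 0, …, Y r` and a
point `b` whose color under `ψ (Y i)` is unchanged by the shifts `Y l / Y i ^ 2 * g`, for `i < l`
and `g ∈ G`. The data `(Y, b)` come from a finite set that does not depend on `ψ`. -/
theorem exists_finset_shift_chain {κ : Type*} [Finite κ] (G : Finset ℚ) (r : ℕ) :
    ∃ Ω : Finset ((ℕ → ℚ) × ℚ), (∀ ω ∈ Ω, ∀ i, ω.1 i ≠ 0) ∧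
      ∀ ψ : ℚ → ℚ → κ, ∃ ω ∈ Ω, ∀ i l, i < l → l ≤ r → ∀ g ∈ G,
        ψ (ω.1 i) (ω.2 + ω.1 l / ω.1 i ^ 2 * g) = ψ (ω.1 i) ω.2 := by
  classical
  induction r with
  | zero =>
    refine ⟨{(1, 0)}, by simp, fun ψ => ⟨(1, 0), by simp, fun i l hi hl => ?_⟩⟩
    omega
  | succ r ih =>
    obtain ⟨Ω, hΩ, hchain⟩ := ih
    let S : Finset ℚ := insert 0 ((Ω ×ˢ Finset.range (r + 1) ×ˢ G).image
      fun p => p.2.2 / p.1.1 p.2.1 ^ 2)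
    obtain ⟨N, hN, hmono⟩ :=
      exists_finset_mono_homothetic_copy (κ := Ω × (Ω → Fin (r + 1) → κ)) S
    refine ⟨(Ω ×ˢ N).image fun p => (Function.update p.1.1 (r + 1) p.2.1, p.2.2 + p.1.2),
      ?_, fun ψ => ?_⟩
    · intro ω hω i
      obtain ⟨⟨ω', p⟩, hp, rfl⟩ := Finset.mem_image.1 hω
      rw [Finset.mem_product] at hp
      by_cases hi : i = r + 1
      · subst hi
        simpa using hN p hp.2
      · simpa [hi] using hΩ ω' hp.1 i
    · choose f hfΩ hf using fun t : ℚ => hchain fun Y q => ψ Y (t + q)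
      obtain ⟨⟨a, b⟩, hp, k, hk⟩ := hmono fun t =>
        (⟨f t, hfΩ t⟩, fun ω i => ψ (ω.1.1 i) (t + ω.1.2))
      have h₀ := hk 0 (Finset.mem_insert_self _ _)
      simp only [mul_zero, add_zero] at h₀
      refine ⟨_, Finset.mem_image_of_mem _ (Finset.mk_mem_product (hfΩ b) hp), ?_⟩
      intro i l hil hl g hg
      have hi : i ≠ r + 1 := by omega
      by_cases hlr : l = r + 1
      · subst hlr
        have hs : g / (f b).1 i ^ 2 ∈ S := Finset.mem_insert_of_mem <| Finset.mem_image.2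
          ⟨(f b, i, g), by simp [hfΩ b, hg, hil], rfl⟩
        have h := congrFun (congrFun (congrArg Prod.snd ((hk _ hs).trans h₀.symm))
          ⟨f b, hfΩ b⟩) ⟨i, hil⟩
        simp only [Function.update_self, Function.update_of_ne hi] at h ⊢
        rw [← h]
        congr 1
        ring
      · have h := hf b i l hil (by omega) g hg
        simp only [Function.update_of_ne hi, Function.update_of_ne hlr]
        rw [← h, add_assoc]

/-- For every finite coloring `χ` of `ℚ` and every finite `G ⊆ ℚ`, there are `x` and `y ≠ 0` such
that `x`, `x * y` and all `x + y * g` with `g ∈ G` have the same color. -/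
theorem exists_mono_mul_add {κ : Type*} [Finite κ] (χ : ℚ → κ) (G : Finset ℚ) :
    ∃ x y : ℚ, y ≠ 0 ∧ χ (x * y) = χ x ∧ ∀ g ∈ G, χ (x + y * g) = χ x := by
  obtain ⟨Ω, hΩ, hchain⟩ := exists_finset_shift_chain (κ := κ) G (Nat.card κ)
  obtain ⟨⟨Y, b⟩, hω, h⟩ := hchain fun q z => χ (q * z)
  have hY : ∀ i, Y i ≠ 0 := hΩ _ hω
  obtain ⟨i, l, hil, hχ⟩ : ∃ i l : Fin (Nat.card κ + 1), i < l ∧ χ (Y i * b) = χ (Y l * b) := by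
    have := Fintype.ofFinite κ
    obtain ⟨i, l, hne, he⟩ := Fintype.exists_ne_map_eq_of_card_lt
      (fun i : Fin (Nat.card κ + 1) => χ (Y i * b)) (by simp)
    rcases lt_or_gt_of_ne hne with hlt | hlt
    exacts [⟨i, l, hlt, he⟩, ⟨l, i, hlt, he.symm⟩]
  refine ⟨Y i * b, Y l / Y i, div_ne_zero (hY l) (hY i), ?_, fun g hg => ?_⟩
  · rw [hχ]
    congr 1
    field_simp [hY i]
  · have h' := h i l hil (Nat.lt_succ_iff.1 l.2) g hg
    simp only at h'
    rw [← h']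
    congr 1
    field_simp [hY i]

/-- If `ℚ = C 1 ∪ ⋯ ∪ C n` with each `C i ∩ (ℚ \ {0})` multiplicatively syndetic, then
some color contains a set `{x, y, x*y, x+y}` with `x, y` nonzero. -/
theorem hindman_quadruple_syndetic (n : ℕ) (C : Fin n → Set ℚ)
    (hcover : ∀ x : ℚ, ∃ i, x ∈ C i)
    (hsynd : ∀ i, MulSyndetic (C i ∩ {q : ℚ | q ≠ 0})) :
    ∃ x y : ℚ, x ≠ 0 ∧ y ≠ 0 ∧ ∃ i,
      x ∈ C i ∧ y ∈ C i ∧ x * y ∈ C i ∧ x + y ∈ C i := by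
  classical
  choose F hF0 hF using hsynd
  let G : Finset ℚ := Finset.univ.biUnion F
  obtain ⟨w, y, hy, hmul, hadd⟩ := exists_mono_mul_add
    (fun q : ℚ => (q = 0, fun (f : G) i => q / f ∈ C i)) (insert 1 G)
  have hw : w ≠ 0 := by
    rintro rfl
    have h := congrArg Prod.fst (hadd 1 (Finset.mem_insert_self _ _))
    simp [hy] at h
  obtain ⟨t, ht⟩ := hcover y
  obtain ⟨f, hf, x, ⟨hx, hx0⟩, rfl⟩ := hF t w hw
  have hf0 : f ≠ 0 := hF0 t f hf
  have hfG : f ∈ G := Finset.mem_biUnion.2 ⟨t, Finset.mem_univ _, hf⟩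
  have hxt : f * x / f ∈ C t := by rwa [mul_div_cancel_left₀ x hf0]
  have hmul' := congrFun (congrFun (congrArg Prod.snd hmul) ⟨f, hfG⟩) t
  have hadd' := congrFun (congrFun (congrArg Prod.snd
    (hadd f (Finset.mem_insert_of_mem hfG))) ⟨f, hfG⟩) t
  refine ⟨x, y, hx0, hy, t, hx, ht, ?_, ?_⟩
  · rw [show x * y = f * x * y / f by field_simp]
    exact hmul'.mpr hxt
  · rw [show x + y = (f * x + y * f) / f by field_simp]
    exact hadd'.mpr hxt
end

section
/- Suppose ℚ = C₁ ∪ C₂ is a coloring of the rationals into two sets such that both C₁ ∩ (ℚ \ {0}) and C₂ ∩ (ℚ \ {0}) are multiplicatively thick. Then there exist nonzero rationals x and y and an index i ∈ {1,2} such that {x, y, x*y, x + y} ⊆ C_i. -/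
/-- `A` contains a quadruple `{x, y, x * y, x + y}` with `x` and `y` nonzero. -/
def HasSumProdQuadruple (A : Set ℚ) : Prop :=
  ∃ x y : ℚ, x ≠ 0 ∧ y ≠ 0 ∧ x ∈ A ∧ y ∈ A ∧ x * y ∈ A ∧ x + y ∈ A

theorem MulThick.exists_dilate_ne {T : Set ℚ} (hT : MulThick T) (F : Finset ℚ)
    (hF : ∀ f ∈ F, f ≠ 0) (hF' : F.Nonempty) (hT0 : ∀ t ∈ T, t ≠ 0) (c : ℚ) :
    ∃ b : ℚ, b ≠ 0 ∧ b ≠ c ∧ ∀ f ∈ F, b * f ∈ T := by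
  obtain ⟨a, ha⟩ := hT (F ∪ F.image (2 * ·)) (by
    intro f hf
    rcases Finset.mem_union.1 hf with hf | hf
    · exact hF f hf
    · obtain ⟨g, hg, rfl⟩ := Finset.mem_image.1 hf
      exact mul_ne_zero two_ne_zero (hF g hg))
  obtain ⟨g, hg⟩ := hF'
  have ha0 : a ≠ 0 := left_ne_zero_of_mul (hT0 _ (ha g (Finset.mem_union_left _ hg)))
  by_cases hac : a = c
  · refine ⟨a * 2, mul_ne_zero ha0 two_ne_zero, fun h => ha0 (by linarith), fun f hf => ?_⟩
    rw [mul_assoc]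
    exact ha _ (Finset.mem_union_right _ (Finset.mem_image_of_mem _ hf))
  · exact ⟨a, ha0, hac, fun f hf => ha f (Finset.mem_union_left _ hf)⟩

/-- In a two-coloring, it suffices for a monochromatic quadruple that
one class is thick and the other contains `1`. -/
theorem hasSumProdQuadruple_of_one_mem {A B : Set ℚ} (hcover : ∀ x : ℚ, x ∈ A ∨ x ∈ B)
    (hB : MulThick (B ∩ {q : ℚ | q ≠ 0})) (one_mem : (1 : ℚ) ∈ A) :
    HasSumProdQuadruple A ∨ HasSumProdQuadruple B := by
  by_contra! ⟨hA, hB'⟩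
  have add_one_mem (x : ℚ) (hx : x ≠ 0) (hxA : x ∈ A) : x + 1 ∈ B :=
    (hcover _).resolve_left fun h =>
      hA ⟨x, 1, hx, one_ne_zero, hxA, one_mem, by rwa [mul_one], h⟩
  have two_mem : (2 : ℚ) ∈ B := by
    simpa [one_add_one_eq_two] using add_one_mem 1 one_ne_zero one_mem
  have three_mem : (3 : ℚ) ∈ B := by
    refine (hcover 3).resolve_left fun h =>
      hB' ⟨2, 2, two_ne_zero, two_ne_zero, two_mem, two_mem, ?_⟩
    have four_mem := add_one_mem 3 three_ne_zero h
    norm_num at four_mem ⊢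
    exact four_mem
  obtain ⟨b, hb0, hb2, hb⟩ := hB.exists_dilate_ne {1, 2, 3} (by simp) (by simp)
    (fun t ht => ht.2) (-2)
  have hb1 : b ∈ B := by simpa using (hb 1 (by simp)).1
  have add_mem (y : ℚ) (hy : y ≠ 0) (hyB : y ∈ B) (hbyB : b * y ∈ B) : b + y ∈ A :=
    (hcover _).resolve_right fun h => hB' ⟨b, y, hb0, hy, hb1, hyB, hbyB, h⟩
  have add_two_mem := add_mem 2 two_ne_zero two_mem (hb 2 (by simp)).1
  have add_three_mem := add_mem 3 three_ne_zero three_mem (hb 3 (by simp)).1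
  refine hA ⟨b + 2, 1, fun h => hb2 (by linarith), one_ne_zero, add_two_mem, one_mem,
    by rwa [mul_one], ?_⟩
  convert add_three_mem using 1
  ring

/-- If `ℚ = C₁ ∪ C₂` with both `C₁ ∩ (ℚ \ {0})` and `C₂ ∩ (ℚ \ {0})` multiplicatively
thick, then one of the two colors contains a set `{x, y, x*y, x+y}` with `x, y`
nonzero. -/
theorem hindman_quadruple_thick (C₁ C₂ : Set ℚ)
    (hcover : ∀ x : ℚ, x ∈ C₁ ∨ x ∈ C₂)
    (h₁ : MulThick (C₁ ∩ {q : ℚ | q ≠ 0}))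
    (h₂ : MulThick (C₂ ∩ {q : ℚ | q ≠ 0})) :
    ∃ x y : ℚ, x ≠ 0 ∧ y ≠ 0 ∧
      ((x ∈ C₁ ∧ y ∈ C₁ ∧ x * y ∈ C₁ ∧ x + y ∈ C₁) ∨
        (x ∈ C₂ ∧ y ∈ C₂ ∧ x * y ∈ C₂ ∧ x + y ∈ C₂)) := by
  have h : HasSumProdQuadruple C₁ ∨ HasSumProdQuadruple C₂ := by
    rcases hcover 1 with h | h
    · exact hasSumProdQuadruple_of_one_mem hcover h₂ h
    · exact (hasSumProdQuadruple_of_one_mem (fun x => (hcover x).symm) h₁ h).symm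
  rcases h with ⟨x, y, hx, hy, h⟩ | ⟨x, y, hx, hy, h⟩
  · exact ⟨x, y, hx, hy, Or.inl h⟩
  · exact ⟨x, y, hx, hy, Or.inr h⟩
end
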